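/- Assume the ULD setting with γ = 2√m, and fix δ ∈ (0,1), r > 0, 𝒯 > 0. Suppose 0 < ε < min{ε̄₁, ε̄₂, ε̄₃}, where ε̄₁ := r·√((C_H+2+(m+1)²)/((C_H+2)m+(m+1)²)), ε̄₂ := 2√2·(C_H+2+(m+1)²)^{1/4}·e^{−1/2}·r·m^{−1/4}, and ε̄₃ := √m / (4L·(√(C_H+2) + (m+1)/√m + (√((C_H+2)m)+(m+1))/(8√(C_H+2+(m+1)²)))). Let 𝒯_rec be the unique T ≥ 1/√m satisfying T·e^{−√m·T} = ε²/(8r²√(C_H+2+(m+1)²)), and let 𝒯_esc := 𝒯_rec + 𝒯. Assume the stepsize satisfies η ≤ min{1, ε·e^{−(1+γ+M)}/(8B), δε²e^{−2(1+γ+M)}/(384(M²C_x^c+(1+γ)²C_v^c)·𝒯_rec), 4γδ²/(9βM²C_v^d·𝒯_esc), γ(d+Ā)/(K₂β), γλ/(2K₁)}, and that β ≥ max{(256(2C_H·m+4m+(m+1)²)/(m·ε²))·(d·log 2 + log((6√(4m+M²+1)·𝒯+3)/δ)), 512dγη·log(2^{1/4}e^{1/4}·6𝒯_rec/(δη))/(ε²·e^{−2(1+γ+M)η})}.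 Then with probability at least 1−δ with respect to the Gaussian noise, at least one of the following events occurs: (1) ‖X_k − x_*‖ ≥ (1/2)(ε + r·e^{−√m·kη}) for some integer k ≤ η^{−1}𝒯_rec; (2) ‖X_k − x_*‖ ≤ ε + r·e^{−√m·kη} for every integer k with η^{−1}𝒯_rec ≤ k ≤ η^{−1}𝒯_esc. -/

import Mathlib

open MeasureTheory ProbabilityTheory Matrix
open scoped RealInnerProductSpace ENNReal NNReal
open Gradient

noncomputable section

/-- The standard Gaussian measure on `EuclideanSpace ℝ (Fin d)`. -/
def stdGaussianE (d : ℕ) : Measure (EuclideanSpace ℝ (Fin d)) :=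
  (Measure.pi fun _ : Fin d => gaussianReal 0 1).map
    (MeasurableEquiv.toLp 2 (Fin d → ℝ))



lemma uld_gauss1 (t u σ α : ℝ) (hα : α = 2 * t * σ ^ 2) (h1 : α < 1) :
    ∫⁻ x, ENNReal.ofReal (Real.exp (t * (u + σ * x) ^ 2)) ∂(gaussianReal 0 1) =
      ENNReal.ofReal ((Real.sqrt (1 - α))⁻¹ * Real.exp (t * u ^ 2 / (1 - α))) := by
  have hp : 0 < 1 - α := by linarith
  obtain ⟨vv, hvv⟩ : ∃ vv : ℝ≥0, (vv : ℝ) = (1 - α)⁻¹ := ⟨Real.toNNReal (1 - α)⁻¹, Real.coe_toNNReal _ (by positivity)⟩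
  have hv : vv ≠ 0 := by
    intro h
    rw [h] at hvv
    have : 0 < (1 - α)⁻¹ := by positivity
    rw [← hvv] at this
    simp at this
  rw [gaussianReal_of_var_ne_zero _ one_ne_zero,
    lintegral_withDensity_eq_lintegral_mul _ (measurable_gaussianPDF _ _) (by fun_prop)]
  have key : ∀ x : ℝ, (gaussianPDF 0 1 * fun x => ENNReal.ofReal (Real.exp (t * (u + σ * x) ^ 2))) x
      = ENNReal.ofReal ((Real.sqrt (1 - α))⁻¹ * Real.exp (t * u ^ 2 / (1 - α))) *
        gaussianPDF (2 * t * u * σ / (1 - α)) vv x := by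
    intro x
    simp only [Pi.mul_apply, gaussianPDF, gaussianPDFReal]
    rw [← ENNReal.ofReal_mul (by positivity), ← ENNReal.ofReal_mul (by positivity)]
    congr 1
    have e1 : Real.sqrt (2 * Real.pi * (1 - α)⁻¹) = Real.sqrt (2 * Real.pi) * (Real.sqrt (1 - α))⁻¹ := by
      rw [Real.sqrt_mul (by positivity), Real.sqrt_inv]
    have hs : Real.sqrt (1 - α) ≠ 0 := (Real.sqrt_pos.2 hp).ne'
    simp only [NNReal.coe_one, hvv, mul_one]
    rw [e1, mul_assoc, ← Real.exp_add]
    have e2 : (Real.sqrt (1 - α))⁻¹ * Real.exp (t * u ^ 2 / (1 - α)) *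
        ((Real.sqrt (2 * Real.pi) * (Real.sqrt (1 - α))⁻¹)⁻¹ *
          Real.exp (-(x - 2 * t * u * σ / (1 - α)) ^ 2 / (2 * (1 - α)⁻¹))) =
        (Real.sqrt (2 * Real.pi))⁻¹ * Real.exp (t * u ^ 2 / (1 - α) +
          -(x - 2 * t * u * σ / (1 - α)) ^ 2 / (2 * (1 - α)⁻¹)) := by
      rw [Real.exp_add]; field_simp
    rw [e2]
    congr 2
    have : (1 - α) ≠ 0 := hp.ne'
    field_simp
    rw [hα]; ring
  simp_rw [key]
  rw [lintegral_const_mul _ (measurable_gaussianPDF _ _), lintegral_gaussianPDF_eq_one _ hv, mul_one]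

lemma uld_gaussE {d : ℕ} (t σ α : ℝ) (u : EuclideanSpace ℝ (Fin d)) (hα : α = 2 * t * σ ^ 2) (h1 : α < 1) :
    ∫⁻ x, ENNReal.ofReal (Real.exp (t * ‖u + σ • x‖ ^ 2)) ∂(stdGaussianE d) =
      ENNReal.ofReal ((Real.sqrt (1 - α))⁻¹ ^ d * Real.exp (t * ‖u‖ ^ 2 / (1 - α))) := by
  rw [stdGaussianE, lintegral_map (by fun_prop) (MeasurableEquiv.measurable _)]
  have key : ∀ x : Fin d → ℝ, ENNReal.ofReal (Real.exp (t * ‖u + σ • (MeasurableEquiv.toLp 2 (Fin d → ℝ)) x‖ ^ 2))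
      = ∏ i, ENNReal.ofReal (Real.exp (t * (u i + σ * x i) ^ 2)) := by
    intro x
    rw [← ENNReal.ofReal_prod_of_nonneg (fun _ _ => by positivity), ← Real.exp_sum, EuclideanSpace.norm_sq_eq,
      Finset.mul_sum]
    simp
  simp_rw [key]
  rw [lintegral_prod_eq_prod_lintegral_of_indepFun Finset.univ
    (fun i (a : Fin d → ℝ) => ENNReal.ofReal (Real.exp (t * (u i + σ * a i) ^ 2)))
    (iIndepFun_pi (X := fun i x => ENNReal.ofReal (Real.exp (t * (u i + σ * x) ^ 2))) (fun i => by fun_prop))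
    (fun i => by fun_prop)]
  have e : ∀ i : Fin d, ∫⁻ a : Fin d → ℝ, ENNReal.ofReal (Real.exp (t * (u i + σ * a i) ^ 2))
      ∂(Measure.pi fun _ : Fin d => gaussianReal 0 1) =
      ENNReal.ofReal ((Real.sqrt (1 - α))⁻¹ * Real.exp (t * (u i) ^ 2 / (1 - α))) := by
    intro i
    rw [← uld_gauss1 t _ σ α hα h1]
    exact (measurePreserving_eval (fun _ : Fin d => gaussianReal 0 1) i).lintegral_comp
      (f := fun x => ENNReal.ofReal (Real.exp (t * (u i + σ * x) ^ 2))) (by fun_prop)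
  simp_rw [e]
  rw [← ENNReal.ofReal_prod_of_nonneg (fun _ _ => by positivity), Finset.prod_mul_distrib, ← Real.exp_sum,
    EuclideanSpace.norm_sq_eq]
  simp [Finset.mul_sum, Finset.sum_div]

lemma uld_chain_meas {Ω S E : Type*} [MeasurableSpace Ω] [MeasurableSpace S] [MeasurableSpace E]
    (ξ : ℕ → Ω → E) (Ψ : ℕ → S → E → S) (hΨ : ∀ k, Measurable (Function.uncurry (Ψ k)))
    (z0 : S) (Z : ℕ → Ω → S) (hZ0 : ∀ ω, Z 0 ω = z0) (hZ : ∀ k ω, Z (k + 1) ω = Ψ k (Z k ω) (ξ k ω)) (k : ℕ) :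
    Measurable[⨆ j ∈ Set.Iio k, MeasurableSpace.comap (ξ j) inferInstance] (Z k) := by
  induction k with
  | zero =>
    have : Z 0 = fun _ => z0 := funext hZ0
    rw [this]; exact @measurable_const _ _ _ (_) _
  | succ k ih =>
    have : Z (k + 1) = fun ω => Function.uncurry (Ψ k) (Z k ω, ξ k ω) := funext (hZ k)
    rw [this]
    refine (hΨ k).comp (Measurable.prodMk ?_ ?_)
    · refine ih.mono ?_ le_rfl
      exact biSup_mono (fun j hj => lt_trans hj (Nat.lt_succ_self k))
    · rw [measurable_iff_comap_le]
      exact le_iSup₂_of_le k (Nat.lt_succ_self k) le_rfl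

lemma uld_chain_step {Ω S E : Type*} [mΩ : MeasurableSpace Ω] [MeasurableSpace S] [MeasurableSpace E]
    (P : Measure Ω) [IsProbabilityMeasure P]
    (ξ : ℕ → Ω → E) (hξmeas : ∀ k, Measurable (ξ k)) (hξindep : iIndepFun ξ P)
    (Ψ : ℕ → S → E → S) (hΨ : ∀ k, Measurable (Function.uncurry (Ψ k)))
    (z0 : S) (Z : ℕ → Ω → S) (hZ0 : ∀ ω, Z 0 ω = z0) (hZ : ∀ k ω, Z (k + 1) ω = Ψ k (Z k ω) (ξ k ω)) (k : ℕ)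
    (f g : S → ℝ≥0∞) (hf : Measurable f) (hg : Measurable g)
    (hfg : ∀ s, ∫⁻ x, f (Ψ k s x) ∂(P.map (ξ k)) ≤ g s) :
    Measurable (Z k) ∧ ∫⁻ ω, f (Z (k + 1) ω) ∂P ≤ ∫⁻ ω, g (Z k ω) ∂P := by
  have hle : ∀ j, MeasurableSpace.comap (ξ j) inferInstance ≤ mΩ := fun j => (hξmeas j).comap_le
  have hm := uld_chain_meas ξ Ψ hΨ z0 Z hZ0 hZ k
  have hZm : Measurable (Z k) := hm.mono (iSup₂_le fun j _ => hle j) le_rfl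
  refine ⟨hZm, ?_⟩
  have hind : IndepFun (Z k) (ξ k) P := by
    have h := indep_iSup_of_disjoint hle hξindep (S := Set.Iio k) (T := {k}) (by simp)
    rw [IndepFun_iff_Indep]
    refine indep_of_indep_of_le_left (indep_of_indep_of_le_right h ?_) hm.comap_le
    simp
  have hmap := (indepFun_iff_map_prod_eq_prod_map_map hZm.aemeasurable (hξmeas k).aemeasurable).1 hind
  have : IsProbabilityMeasure (P.map (ξ k)) := Measure.isProbabilityMeasure_map (hξmeas k).aemeasurable
  have hmm : Measurable (fun p : S × E => f (Ψ k p.1 p.2)) := hf.comp (hΨ k)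
  calc ∫⁻ ω, f (Z (k + 1) ω) ∂P = ∫⁻ ω, (fun p : S × E => f (Ψ k p.1 p.2)) (Z k ω, ξ k ω) ∂P := by simp [hZ]
    _ = ∫⁻ p, (fun p : S × E => f (Ψ k p.1 p.2)) p ∂(P.map (fun ω => (Z k ω, ξ k ω))) := by
        rw [lintegral_map hmm (hZm.prodMk (hξmeas k))]
    _ = ∫⁻ s, ∫⁻ x, f (Ψ k s x) ∂(P.map (ξ k)) ∂(P.map (Z k)) := by
        rw [hmap, lintegral_prod _ hmm.aemeasurable]
    _ ≤ ∫⁻ s, g s ∂(P.map (Z k)) := lintegral_mono hfg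
    _ = _ := lintegral_map hg hZm

/-- Modified energy used as a Lyapunov function for the linearised noise process. -/
def uldEn {d : ℕ} (b : OrthonormalBasis (Fin d) ℝ (EuclideanSpace ℝ (Fin d))) (lam : Fin d → ℝ) (s : ℝ)
    (p : EuclideanSpace ℝ (Fin d) × EuclideanSpace ℝ (Fin d)) : ℝ :=
  ‖p.1 + (s / 2) • p.2‖ ^ 2 + ∑ i, (lam i - s ^ 2 / 4) * ⟪b i, p.2⟫ ^ 2

/-- One step of the linearised dynamics with additive perturbation `w` of the velocity. -/
def uldStep {d : ℕ} (T : EuclideanSpace ℝ (Fin d) →L[ℝ] EuclideanSpace ℝ (Fin d)) (γ η : ℝ)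
    (p : EuclideanSpace ℝ (Fin d) × EuclideanSpace ℝ (Fin d)) (w : EuclideanSpace ℝ (Fin d)) :
    EuclideanSpace ℝ (Fin d) × EuclideanSpace ℝ (Fin d) :=
  (p.1 - η • (γ • p.1 + T p.2) + w, p.2 + η • p.1)

lemma uld_quad (v z : ℝ) : |v| * |z| ≤ 7 / 4 * v ^ 2 + 7 / 24 * z ^ 2 := by
  rw [← sq_abs v, ← sq_abs z]
  nlinarith [sq_nonneg (|v| - 2 / 7 * |z|), sq_nonneg (|z|)]

lemma uld_mode (s η l v y α : ℝ) (hs : 0 < s) (hη : 0 < η) (hh : η * s ≤ 1 / 12)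
    (hl : s ^ 2 ≤ l) (hl2 : η * l ≤ s / 12) (hα : 0 ≤ α) (hα2 : α ≤ η * s / 2) :
    ((v - η * (2 * s * v + l * y)) + s / 2 * (y + η * v)) ^ 2 / (1 - α) + (l - s ^ 2 / 4) * (y + η * v) ^ 2 ≤
      (1 - η * s / 2) * ((v + s / 2 * y) ^ 2 + (l - s ^ 2 / 4) * y ^ 2) := by
  -- normalised variables
  obtain ⟨h, rfl⟩ : ∃ h, η = h / s := ⟨η * s, by field_simp⟩
  obtain ⟨z, rfl⟩ : ∃ z, y = z / s := ⟨y * s, by field_simp⟩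
  obtain ⟨Λ, rfl⟩ : ∃ Λ, l = s ^ 2 * Λ := ⟨l / s ^ 2, by field_simp⟩
  have hh' : h / s * s = h := by field_simp
  rw [hh'] at hh hα2 
  have hhp : 0 < h := by rw [← hh']; positivity
  have hΛ : 1 ≤ Λ := by
    by_contra hc
    push Not at hc
    nlinarith [pow_pos hs 2]
  have hhΛ : h * Λ ≤ 1 / 12 := by
    have : h / s * (s ^ 2 * Λ) = s * (h * Λ) := by field_simp
    rw [this] at hl2
    by_contra hc
    push Not at hc
    nlinarith
  have e1 : (v - h / s * (2 * s * v + s ^ 2 * Λ * (z / s))) + s / 2 * (z / s + h / s * v) =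
      (1 - 3 / 2 * h) * v + (1 / 2 - h * Λ) * z := by field_simp; ring
  have e2 : (s ^ 2 * Λ - s ^ 2 / 4) * (z / s + h / s * v) ^ 2 = (Λ - 1 / 4) * (z + h * v) ^ 2 := by field_simp
  have e3 : (1 - h / s * s / 2) * ((v + s / 2 * (z / s)) ^ 2 + (s ^ 2 * Λ - s ^ 2 / 4) * (z / s) ^ 2) =
      (1 - h / 2) * ((v + z / 2) ^ 2 + (Λ - 1 / 4) * z ^ 2) := by field_simp
  rw [e1, e2, e3]
  have hd : ((1 - 3 / 2 * h) * v + (1 / 2 - h * Λ) * z) ^ 2 / (1 - α) ≤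
      ((1 - 3 / 2 * h) * v + (1 / 2 - h * Λ) * z) ^ 2 / (1 - h / 2) := by
    apply div_le_div_of_nonneg_left (by positivity) (by linarith) (by linarith)
  refine le_trans (add_le_add_left hd _) ?_
  rw [← le_sub_iff_add_le, div_le_iff₀ (by linarith)]
  have id : ((1 - h / 2) * ((v + z / 2) ^ 2 + (Λ - 1 / 4) * z ^ 2) - (Λ - 1 / 4) * (z + h * v) ^ 2) * (1 - h / 2)
      - ((1 - 3 / 2 * h) * v + (1 / 2 - h * Λ) * z) ^ 2 =
      h * ((2 - 2 * h - (1 - h / 2) * (h * Λ - h / 4)) * v ^ 2 + (1 - 2 * (h * Λ)) * (v * z) +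
        (Λ / 2 - 1 / 8 + h * Λ / 4 - h * Λ * Λ) * z ^ 2) := by ring
  have hwh : h ≤ h * Λ := by nlinarith
  have hA : (7 / 4 : ℝ) ≤ 2 - 2 * h - (1 - h / 2) * (h * Λ - h / 4) := by
    have : (1 - h / 2) * (h * Λ - h / 4) ≤ 1 * (h * Λ - h / 4) :=
      mul_le_mul_of_nonneg_right (by linarith) (by linarith)
    linarith
  have hC : (7 / 24 : ℝ) ≤ Λ / 2 - 1 / 8 + h * Λ / 4 - h * Λ * Λ := by
    have : h * Λ * Λ ≤ 1 / 12 * Λ := mul_le_mul_of_nonneg_right hhΛ (by linarith)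
    linarith
  have hB : |1 - 2 * (h * Λ)| ≤ 1 := by
    rw [abs_le]; constructor <;> linarith
  have hB2 : -(|v| * |z|) ≤ (1 - 2 * (h * Λ)) * (v * z) := by
    have : |(1 - 2 * (h * Λ)) * (v * z)| ≤ |v| * |z| := by
      rw [abs_mul, abs_mul]
      have := mul_nonneg (abs_nonneg v) (abs_nonneg z)
      exact mul_le_of_le_one_left this hB
    linarith [neg_abs_le ((1 - 2 * (h * Λ)) * (v * z))]
  have hfin : 0 ≤ (2 - 2 * h - (1 - h / 2) * (h * Λ - h / 4)) * v ^ 2 + (1 - 2 * (h * Λ)) * (v * z) +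
        (Λ / 2 - 1 / 8 + h * Λ / 4 - h * Λ * Λ) * z ^ 2 := by
    have h1 := mul_le_mul_of_nonneg_right hA (sq_nonneg v)
    have h2 := mul_le_mul_of_nonneg_right hC (sq_nonneg z)
    have h3 := uld_quad v z
    linarith
  have := mul_nonneg hhp.le hfin
  linarith

section
variable {d : ℕ} (b : OrthonormalBasis (Fin d) ℝ (EuclideanSpace ℝ (Fin d))) (lam : Fin d → ℝ)
  (T : EuclideanSpace ℝ (Fin d) →L[ℝ] EuclideanSpace ℝ (Fin d))

lemma uld_inner_T (hT : ∀ i, T (b i) = lam i • b i) (i : Fin d) (y : EuclideanSpace ℝ (Fin d)) :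
    ⟪b i, T y⟫ = lam i * ⟪b i, y⟫ := by
  conv_lhs => rw [← b.sum_repr y]
  simp only [map_sum, map_smul, hT, inner_sum, inner_smul_right, b.inner_eq_ite, b.repr_apply_apply]
  simp [Finset.sum_ite_eq]
  ring

lemma uld_norm_sq (y : EuclideanSpace ℝ (Fin d)) : ‖y‖ ^ 2 = ∑ i, ⟪b i, y⟫ ^ 2 := by
  rw [← b.sum_sq_norm_inner_right y]
  simp

lemma uld_contract (hT : ∀ i, T (b i) = lam i • b i) (s η α : ℝ) (hs : 0 < s) (hη : 0 < η)
    (hh : η * s ≤ 1 / 12)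
    (hl : ∀ i, s ^ 2 ≤ lam i) (hl2 : ∀ i, η * lam i ≤ s / 12) (hα : 0 ≤ α) (hα2 : α ≤ η * s / 2)
    (p : EuclideanSpace ℝ (Fin d) × EuclideanSpace ℝ (Fin d)) :
    ‖(p.1 - η • ((2 * s) • p.1 + T p.2)) + (s / 2) • (p.2 + η • p.1)‖ ^ 2 / (1 - α) +
      ∑ i, (lam i - s ^ 2 / 4) * ⟪b i, p.2 + η • p.1⟫ ^ 2 ≤ (1 - η * s / 2) * uldEn b lam s p := by
  rw [uldEn, uld_norm_sq b, uld_norm_sq b, Finset.sum_div, ← Finset.sum_add_distrib, ← Finset.sum_add_distrib,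
    Finset.mul_sum]
  refine Finset.sum_le_sum fun i _ => ?_
  have := uld_mode s η (lam i) ⟪b i, p.1⟫ ⟪b i, p.2⟫ α hs hη hh (hl i) (hl2 i) hα hα2
  simp only [inner_add_right, inner_sub_right, inner_smul_right, uld_inner_T b lam T hT]
  exact this

lemma uld_En_nonneg (s : ℝ) (hl : ∀ i, s ^ 2 ≤ lam i)
    (p : EuclideanSpace ℝ (Fin d) × EuclideanSpace ℝ (Fin d)) :
    3 / 4 * s ^ 2 * ‖p.2‖ ^ 2 ≤ uldEn b lam s p := by
  rw [uldEn, uld_norm_sq b p.2, Finset.mul_sum]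
  have : ∑ i, 3 / 4 * s ^ 2 * ⟪b i, p.2⟫ ^ 2 ≤ ∑ i, (lam i - s ^ 2 / 4) * ⟪b i, p.2⟫ ^ 2 :=
    Finset.sum_le_sum fun i _ => mul_le_mul_of_nonneg_right (by linarith [hl i]) (sq_nonneg _)
  linarith [sq_nonneg ‖p.1 + (s / 2) • p.2‖]

lemma uld_mgf_step (hT : ∀ i, T (b i) = lam i • b i) (s η β σ t : ℝ) (hs : 0 < s) (hη : 0 < η) (hβ : 0 < β)
    (hh : η * s ≤ 1 / 12) (hσ : σ ^ 2 = 4 * s * η / β)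
    (hl : ∀ i, s ^ 2 ≤ lam i) (hl2 : ∀ i, η * lam i ≤ s / 12) (ht : 0 ≤ t) (ht2 : t ≤ β / 16)
    (p : EuclideanSpace ℝ (Fin d) × EuclideanSpace ℝ (Fin d)) :
    ∫⁻ x, ENNReal.ofReal (Real.exp (t * uldEn b lam s (uldStep T (2 * s) η p (σ • x)))) ∂(stdGaussianE d) ≤
      ENNReal.ofReal (Real.exp (d * (9 / 2 * t * (η * s) / β) + t * ((1 - η * s / 2) * uldEn b lam s p))) := by
  set α := 2 * t * σ ^ 2 with hαdef
  have hα' : α = 8 * t / β * (η * s) := by rw [hαdef, hσ]; ring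
  have ht3 : 8 * t / β ≤ 1 / 2 := by rw [div_le_iff₀ hβ]; linarith
  have hhp : 0 < η * s := by positivity
  have hα0 : 0 ≤ α := by rw [hα']; positivity
  have hα2 : α ≤ η * s / 2 := by rw [hα']; nlinarith
  set Q := ∑ i, (lam i - s ^ 2 / 4) * ⟪b i, p.2 + η • p.1⟫ ^ 2 with hQ
  set u := (p.1 - η • ((2 * s) • p.1 + T p.2)) + (s / 2) • (p.2 + η • p.1) with hu
  have hc := uld_contract b lam T hT s η α hs hη hh hl hl2 hα0 hα2 p
  have e : ∀ x, ENNReal.ofReal (Real.exp (t * uldEn b lam s (uldStep T (2 * s) η p (σ • x)))) =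
      ENNReal.ofReal (Real.exp (t * Q)) * ENNReal.ofReal (Real.exp (t * ‖u + σ • x‖ ^ 2)) := by
    intro x
    rw [← ENNReal.ofReal_mul (by positivity), ← Real.exp_add, uldEn, uldStep, hQ, hu]
    congr 2
    simp only
    have : p.1 - η • ((2 * s) • p.1 + T p.2) + σ • x + (s / 2) • (p.2 + η • p.1) =
      (p.1 - η • ((2 * s) • p.1 + T p.2)) + (s / 2) • (p.2 + η • p.1) + σ • x := by abel
    rw [this]; ring
  simp_rw [e]
  rw [lintegral_const_mul _ (by fun_prop), uld_gaussE t σ α u hαdef (by linarith),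
    ← ENNReal.ofReal_mul (by positivity)]
  apply ENNReal.ofReal_le_ofReal
  have hg : (Real.sqrt (1 - α))⁻¹ ≤ Real.exp (9 / 2 * t * (η * s) / β) := by
    have h1 : 0 < 1 - α := by linarith
    rw [inv_le_comm₀ (Real.sqrt_pos.2 h1) (Real.exp_pos _), ← Real.exp_neg]
    apply Real.le_sqrt_of_sq_le
    rw [← Real.exp_nat_mul]
    have h9 : 9 / 2 * t * (η * s) / β = 9 / 16 * α := by rw [hα']; ring
    rw [h9]
    have h2 := Real.add_one_le_exp (9 / 8 * α)
    have h3 : ((2 : ℕ) : ℝ) * (-(9 / 16 * α)) = -(9 / 8 * α) := by push_cast; ring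
    rw [h3, Real.exp_neg, inv_le_comm₀ (Real.exp_pos _) h1]
    refine le_trans ?_ h2
    rw [inv_le_iff_one_le_mul₀ h1]
    nlinarith
  have hgd : (Real.sqrt (1 - α))⁻¹ ^ d ≤ Real.exp (d * (9 / 2 * t * (η * s) / β)) := by
    rw [Real.exp_nat_mul]
    exact pow_le_pow_left₀ (by positivity) hg d
  calc Real.exp (t * Q) * ((Real.sqrt (1 - α))⁻¹ ^ d * Real.exp (t * ‖u‖ ^ 2 / (1 - α)))
      ≤ Real.exp (t * Q) * (Real.exp (d * (9 / 2 * t * (η * s) / β)) * Real.exp (t * ‖u‖ ^ 2 / (1 - α))) := by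
        gcongr
    _ = Real.exp (d * (9 / 2 * t * (η * s) / β) + t * (‖u‖ ^ 2 / (1 - α) + Q)) := by
        rw [← Real.exp_add, ← Real.exp_add]; congr 1; ring
    _ ≤ _ := by
        apply Real.exp_le_exp.2
        have := mul_le_mul_of_nonneg_left hc ht
        linarith

end

/-- The linearised noise process started at zero. -/
def uldNoise {d : ℕ} (T : EuclideanSpace ℝ (Fin d) →L[ℝ] EuclideanSpace ℝ (Fin d)) (γ η σ : ℝ)
    (w : ℕ → EuclideanSpace ℝ (Fin d)) : ℕ → EuclideanSpace ℝ (Fin d) × EuclideanSpace ℝ (Fin d)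
  | 0 => (0, 0)
  | k + 1 => uldStep T γ η (uldNoise T γ η σ w k) (σ • w k)

/-- The noise process, frozen once the energy exceeds `c` after time `K`. -/
def uldStop {d : ℕ} (T : EuclideanSpace ℝ (Fin d) →L[ℝ] EuclideanSpace ℝ (Fin d)) (γ η σ : ℝ)
    (Q : EuclideanSpace ℝ (Fin d) × EuclideanSpace ℝ (Fin d) → ℝ) (K : ℕ) (c : ℝ)
    (k : ℕ) (p : EuclideanSpace ℝ (Fin d) × EuclideanSpace ℝ (Fin d)) (x : EuclideanSpace ℝ (Fin d)) :
    EuclideanSpace ℝ (Fin d) × EuclideanSpace ℝ (Fin d) :=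
  open Classical in if K ≤ k ∧ c ≤ Q p then p else uldStep T γ η p (σ • x)

def uldStopChain {d : ℕ} (T : EuclideanSpace ℝ (Fin d) →L[ℝ] EuclideanSpace ℝ (Fin d)) (γ η σ : ℝ)
    (Q : EuclideanSpace ℝ (Fin d) × EuclideanSpace ℝ (Fin d) → ℝ) (K : ℕ) (c : ℝ)
    (w : ℕ → EuclideanSpace ℝ (Fin d)) : ℕ → EuclideanSpace ℝ (Fin d) × EuclideanSpace ℝ (Fin d)
  | 0 => (0, 0)
  | k + 1 => uldStop T γ η σ Q K c k (uldStopChain T γ η σ Q K c w k) (w k)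

section
variable {d : ℕ} (b : OrthonormalBasis (Fin d) ℝ (EuclideanSpace ℝ (Fin d))) (lam : Fin d → ℝ)
  (T : EuclideanSpace ℝ (Fin d) →L[ℝ] EuclideanSpace ℝ (Fin d))

lemma uld_En_meas (s : ℝ) : Measurable (uldEn b lam s) := by
  have : Continuous (uldEn b lam s) := by unfold uldEn; fun_prop
  exact this.measurable

lemma uld_stop_meas (γ η σ : ℝ) (Q : EuclideanSpace ℝ (Fin d) × EuclideanSpace ℝ (Fin d) → ℝ) (hQ : Measurable Q)
    (K : ℕ) (c : ℝ) (k : ℕ) : Measurable (Function.uncurry (uldStop T γ η σ Q K c k)) := by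
  unfold Function.uncurry uldStop
  refine Measurable.ite ?_ measurable_fst ?_
  · exact (MeasurableSet.const _).inter (measurableSet_le measurable_const (hQ.comp measurable_fst))
  · have : Continuous (fun a : (EuclideanSpace ℝ (Fin d) × EuclideanSpace ℝ (Fin d)) × EuclideanSpace ℝ (Fin d) =>
      uldStep T γ η a.1 (σ • a.2)) := by unfold uldStep; fun_prop
    exact this.measurable

lemma uld_stop_cases (γ η σ : ℝ) (Q : EuclideanSpace ℝ (Fin d) × EuclideanSpace ℝ (Fin d) → ℝ)
    (K : ℕ) (c : ℝ) (w : ℕ → EuclideanSpace ℝ (Fin d)) :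
    (∀ k ≤ K, uldStopChain T γ η σ Q K c w k = uldNoise T γ η σ w k) ∧
    ∀ j, (uldStopChain T γ η σ Q K c w (K + j) = uldNoise T γ η σ w (K + j) ∧
      ∀ i < j, Q (uldNoise T γ η σ w (K + i)) < c) ∨ c ≤ Q (uldStopChain T γ η σ Q K c w (K + j)) := by
  have h1 : ∀ k ≤ K, uldStopChain T γ η σ Q K c w k = uldNoise T γ η σ w k := by
    intro k
    induction k with
    | zero => intro _; rfl
    | succ k ih =>
      intro hk
      rw [uldStopChain, uldNoise, ih (by omega), uldStop, if_neg (by omega)]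
  refine ⟨h1, fun j => ?_⟩
  induction j with
  | zero => left; exact ⟨h1 K le_rfl, by simp⟩
  | succ j ih =>
    rcases ih with ⟨h2, h3⟩ | h2
    · by_cases hc : c ≤ Q (uldNoise T γ η σ w (K + j))
      · right
        rw [← add_assoc, uldStopChain, uldStop, if_pos ⟨by omega, by rwa [h2]⟩, h2]; exact hc
      · left
        refine ⟨?_, ?_⟩
        · rw [← add_assoc, uldStopChain, uldStop, if_neg (by rw [h2]; tauto), uldNoise, h2]
        · intro i hi
          rcases Nat.lt_succ_iff_lt_or_eq.1 hi with h | h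
          · exact h3 i h
          · subst h; exact not_le.1 hc
    · right
      rw [← add_assoc, uldStopChain, uldStop, if_pos ⟨by omega, h2⟩]; exact h2

lemma uld_block {Ω : Type*} [MeasurableSpace Ω] (P : Measure Ω) [IsProbabilityMeasure P]
    (ξ : ℕ → Ω → EuclideanSpace ℝ (Fin d)) (hξmeas : ∀ k, Measurable (ξ k))
    (hξindep : iIndepFun ξ P) (hξ : ∀ k, Measure.map (ξ k) P = stdGaussianE d)
    (hT : ∀ i, T (b i) = lam i • b i) (s η β σ : ℝ) (hs : 0 < s) (hη : 0 < η) (hβ : 0 < β)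
    (hh : η * s ≤ 1 / 12) (hσ : σ ^ 2 = 4 * s * η / β)
    (hl : ∀ i, s ^ 2 ≤ lam i) (hl2 : ∀ i, η * lam i ≤ s / 12) (K W : ℕ) (c : ℝ) :
    P {ω | ∃ k, K ≤ k ∧ k ≤ K + W ∧ c ≤ uldEn b lam s (uldNoise T (2 * s) η σ (fun n => ξ n ω) k)} ≤
      ENNReal.ofReal (Real.exp (-(β / 16 * c) + d * (9 / 16 + 9 / 32 * (η * s) * W))) := by
  set Q := uldEn b lam s with hQdef
  have hQ : Measurable Q := uld_En_meas b lam s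
  set Z : ℕ → Ω → EuclideanSpace ℝ (Fin d) × EuclideanSpace ℝ (Fin d) :=
    fun k ω => uldStopChain T (2 * s) η σ Q K c (fun n => ξ n ω) k with hZdef
  have hQ0 : Q (0, 0) = 0 := by simp [hQdef, uldEn]
  have hQn : ∀ p, 0 ≤ Q p := fun p => le_trans (by positivity) (uld_En_nonneg b lam s hl p)
  have step := fun k f g hf hg hfg => uld_chain_step P ξ hξmeas hξindep (uldStop T (2 * s) η σ Q K c)
    (uld_stop_meas T (2 * s) η σ Q hQ K c) (0, 0) Z (fun ω => rfl) (fun k ω => rfl) k f g hf hg hfg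
  have hmeasE : ∀ t c1 : ℝ, Measurable (fun p => ENNReal.ofReal (Real.exp (c1 + t * Q p))) := by
    intro t c1; fun_prop
  have hhp : 0 < η * s := by positivity
  have ph1 : ∀ k ≤ K, ∀ t, 0 ≤ t → t ≤ β / 16 →
      ∫⁻ ω, ENNReal.ofReal (Real.exp (0 + t * Q (Z k ω))) ∂P ≤ ENNReal.ofReal (Real.exp (9 * d * t / β)) := by
    intro k
    induction k with
    | zero =>
      intro _ t ht _
      have : ∀ ω, Z 0 ω = (0, 0) := fun ω => rfl
      simp only [this, hQ0, mul_zero, add_zero, lintegral_const, measure_univ, mul_one]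
      exact ENNReal.ofReal_le_ofReal (Real.exp_le_exp.2 (by positivity))
    | succ k ih =>
      intro hk t ht ht2
      have h1 := (step k (fun p => ENNReal.ofReal (Real.exp (0 + t * Q p)))
        (fun p => ENNReal.ofReal (Real.exp (d * (9 / 2 * t * (η * s) / β) + (t * (1 - η * s / 2)) * Q p)))
        (hmeasE _ _) (hmeasE _ _) (by
          intro p
          rw [hξ]
          have := uld_mgf_step b lam T hT s η β σ t hs hη hβ hh hσ hl hl2 ht ht2 p
          simp only [uldStop, zero_add]
          rw [mul_assoc t (1 - η * s / 2)]
          simp only [show ¬ (K ≤ k ∧ c ≤ Q p) by omega, if_false]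
          exact this)).2
      refine h1.trans ?_
      have h2 := ih (by omega) (t * (1 - η * s / 2)) (by apply mul_nonneg ht; linarith) (by nlinarith)
      have e : ∀ ω, ENNReal.ofReal (Real.exp (d * (9 / 2 * t * (η * s) / β) + (t * (1 - η * s / 2)) * Q (Z k ω))) =
          ENNReal.ofReal (Real.exp (d * (9 / 2 * t * (η * s) / β))) *
            ENNReal.ofReal (Real.exp (0 + (t * (1 - η * s / 2)) * Q (Z k ω))) := by
        intro ω
        rw [← ENNReal.ofReal_mul (by positivity), ← Real.exp_add, zero_add]
      simp only [e]
      rw [lintegral_const_mul' _ _ ENNReal.ofReal_ne_top]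
      refine (mul_le_mul_right h2 _).trans ?_
      rw [← ENNReal.ofReal_mul (by positivity), ← Real.exp_add]
      apply ENNReal.ofReal_le_ofReal (Real.exp_le_exp.2 (le_of_eq _))
      field_simp; ring
  have ph2 : ∀ j : ℕ, ∫⁻ ω, ENNReal.ofReal (Real.exp (0 + β / 16 * Q (Z (K + j) ω))) ∂P ≤
      ENNReal.ofReal (Real.exp (d * (9 / 16 + 9 / 32 * (η * s) * j))) := by
    intro j
    induction j with
    | zero =>
      refine (ph1 K le_rfl (β / 16) (by positivity) le_rfl).trans ?_
      apply ENNReal.ofReal_le_ofReal (Real.exp_le_exp.2 (le_of_eq _))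
      push_cast; field_simp; ring
    | succ j ih =>
      have h1 := (step (K + j) (fun p => ENNReal.ofReal (Real.exp (0 + β / 16 * Q p)))
        (fun p => ENNReal.ofReal (Real.exp (d * (9 / 32 * (η * s)) + β / 16 * Q p)))
        (hmeasE _ _) (hmeasE _ _) (by
          intro p
          by_cases hc : c ≤ Q p
          · have : IsProbabilityMeasure (P.map (ξ (K + j))) :=
              Measure.isProbabilityMeasure_map (hξmeas _).aemeasurable
            simp only [uldStop, show K ≤ K + j ∧ c ≤ Q p from ⟨by omega, hc⟩, and_self, if_true, lintegral_const, measure_univ, mul_one]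
            apply ENNReal.ofReal_le_ofReal (Real.exp_le_exp.2 _)
            have : 0 ≤ (d : ℝ) * (9 / 32 * (η * s)) := by positivity
            linarith
          · rw [hξ]
            have := uld_mgf_step b lam T hT s η β σ (β / 16) hs hη hβ hh hσ hl hl2 (by positivity) le_rfl p
            simp only [uldStop, zero_add]
            simp only [show ¬ (K ≤ K + j ∧ c ≤ Q p) by tauto, if_false]
            refine this.trans (ENNReal.ofReal_le_ofReal (Real.exp_le_exp.2 ?_))
            have e : (9 / 2 * (β / 16) * (η * s) / β) = 9 / 32 * (η * s) := by field_simp; ring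
            rw [e]
            have h3 : (1 - η * s / 2) * Q p ≤ Q p := by nlinarith [hQn p]
            have := mul_le_mul_of_nonneg_left h3 (show 0 ≤ β / 16 by positivity)
            linarith)).2
      refine h1.trans ?_
      have e : ∀ ω, ENNReal.ofReal (Real.exp (d * (9 / 32 * (η * s)) + β / 16 * Q (Z (K + j) ω))) =
          ENNReal.ofReal (Real.exp (d * (9 / 32 * (η * s)))) *
            ENNReal.ofReal (Real.exp (0 + β / 16 * Q (Z (K + j) ω))) := by
        intro ω
        rw [← ENNReal.ofReal_mul (by positivity), ← Real.exp_add, zero_add]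
      simp only [e]
      rw [lintegral_const_mul' _ _ ENNReal.ofReal_ne_top]
      refine (mul_le_mul_right ih _).trans ?_
      rw [← ENNReal.ofReal_mul (by positivity), ← Real.exp_add]
      apply ENNReal.ofReal_le_ofReal (Real.exp_le_exp.2 (le_of_eq _))
      push_cast; ring
  have hZm : Measurable (Z (K + W)) := (step (K + W) 0 0 measurable_zero measurable_zero (by simp)).1
  have hmk := mul_meas_ge_le_lintegral (μ := P) (f := fun ω => ENNReal.ofReal (Real.exp (0 + β / 16 * Q (Z (K + W) ω))))
    ((hmeasE _ _).comp hZm) (ENNReal.ofReal (Real.exp (β / 16 * c)))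
  have hsub : {ω | ∃ k, K ≤ k ∧ k ≤ K + W ∧ c ≤ Q (uldNoise T (2 * s) η σ (fun n => ξ n ω) k)} ⊆
      {ω | ENNReal.ofReal (Real.exp (β / 16 * c)) ≤ ENNReal.ofReal (Real.exp (0 + β / 16 * Q (Z (K + W) ω)))} := by
    rintro ω ⟨k, hk1, hk2, hk3⟩
    apply ENNReal.ofReal_le_ofReal (Real.exp_le_exp.2 _)
    rw [zero_add]
    apply mul_le_mul_of_nonneg_left _ (by positivity)
    rcases (uld_stop_cases T (2 * s) η σ Q K c (fun n => ξ n ω)).2 W with ⟨h1, h2⟩ | h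
    · obtain ⟨i, rfl⟩ := Nat.exists_eq_add_of_le hk1
      rcases Nat.lt_or_eq_of_le (show i ≤ W by omega) with h | h
      · exact absurd hk3 (not_le.2 (h2 i h))
      · subst h; rw [hZdef]; simp only [h1]; exact hk3
    · exact h
  refine (measure_mono hsub).trans ?_
  have h3 := hmk.trans (ph2 W)
  have hpos : ENNReal.ofReal (Real.exp (β / 16 * c)) ≠ 0 := by
    rw [ne_eq, ENNReal.ofReal_eq_zero, not_le]; positivity
  rw [mul_comm] at h3
  refine ((ENNReal.le_div_iff_mul_le (Or.inl hpos) (Or.inl ENNReal.ofReal_ne_top)).2 h3).trans ?_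
  rw [← ENNReal.ofReal_div_of_pos (by positivity), ← Real.exp_sub]
  apply ENNReal.ofReal_le_ofReal (Real.exp_le_exp.2 (le_of_eq _))
  ring


lemma uld_noise_prob {Ω : Type*} [MeasurableSpace Ω] (P : Measure Ω) [IsProbabilityMeasure P]
    (ξ : ℕ → Ω → EuclideanSpace ℝ (Fin d)) (hξmeas : ∀ k, Measurable (ξ k))
    (hξindep : iIndepFun ξ P) (hξ : ∀ k, Measure.map (ξ k) P = stdGaussianE d)
    (hT : ∀ i, T (b i) = lam i • b i) (s η β σ : ℝ) (hs : 0 < s) (hη : 0 < η) (hβ : 0 < β)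
    (hh : η * s ≤ 1 / 12) (hσ : σ ^ 2 = 4 * s * η / β)
    (hl : ∀ i, s ^ 2 ≤ lam i) (hl2 : ∀ i, η * lam i ≤ s / 12)
    (Sd ε δ 𝒯 : ℝ) (hSd : 0 < Sd) (hSd2 : 2 * s ≤ Sd) (hε : 0 < ε) (hδ : 0 < δ) (hδ1 : δ < 1) (h𝒯 : 0 < 𝒯)
    (hβ' : 256 / (s ^ 2 * ε ^ 2) * (d * Real.log 2 + Real.log ((6 * Sd * 𝒯 + 3) / δ)) ≤ β) (K0 : ℕ) :
    P {ω | ∃ k : ℕ, K0 ≤ k ∧ (k : ℝ) ≤ K0 + 𝒯 / η ∧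
      3 * ε / 8 ≤ ‖(uldNoise T (2 * s) η σ (fun n => ξ n ω) k).2‖} ≤ ENNReal.ofReal δ := by
  set W : ℕ := ⌈1 / (η * Sd)⌉₊ with hW
  set J : ℕ := ⌊𝒯 * Sd⌋₊ with hJ
  set c : ℝ := 27 / 256 * (s ^ 2 * ε ^ 2) with hc
  have hWpos : 0 < W := Nat.ceil_pos.2 (by positivity)
  have hW1 : 1 / (η * Sd) ≤ W := Nat.le_ceil _
  have hW2 : (W : ℝ) < 1 / (η * Sd) + 1 := Nat.ceil_lt_add_one (by positivity)
  have hJ1 : (J : ℝ) ≤ 𝒯 * Sd := Nat.floor_le (by positivity)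
  have hJ2 : 𝒯 * Sd < J + 1 := Nat.lt_floor_add_one _
  have hhW : η * s * W ≤ 7 / 12 := by
    have h1 : η * s * W ≤ η * s * (1 / (η * Sd) + 1) := by gcongr
    have h2 : η * s * (1 / (η * Sd) + 1) = s / Sd + η * s := by field_simp
    have h3 : s / Sd ≤ 1 / 2 := by rw [div_le_iff₀ hSd]; linarith
    linarith
  set Lg := Real.log ((6 * Sd * 𝒯 + 3) / δ) with hLg
  have hq : 1 ≤ (6 * Sd * 𝒯 + 3) / δ := by
    rw [le_div_iff₀ hδ]; have : 0 < Sd * 𝒯 := by positivity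
    linarith
  have hLg0 : 0 ≤ Lg := Real.log_nonneg hq
  have hθ : 27 / 16 * (d * Real.log 2 + Lg) ≤ β / 16 * c := by
    have h1 := mul_le_mul_of_nonneg_right hβ' (show 0 ≤ 27 / 4096 * (s ^ 2 * ε ^ 2) by positivity)
    have h2 : 256 / (s ^ 2 * ε ^ 2) * (d * Real.log 2 + Lg) * (27 / 4096 * (s ^ 2 * ε ^ 2)) =
      27 / 16 * (d * Real.log 2 + Lg) := by field_simp; ring
    rw [h2] at h1
    rw [hc]; linarith
  have hexp : Real.exp (-(β / 16 * c) + d * (9 / 16 + 9 / 32 * (η * s) * W)) ≤ δ / (6 * Sd * 𝒯 + 3) := by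
    have h1 : Real.exp (-Lg) = δ / (6 * Sd * 𝒯 + 3) := by
      rw [Real.exp_neg, Real.exp_log (by linarith), inv_div]
    rw [← h1]
    apply Real.exp_le_exp.2
    have h2 : (d : ℝ) * (9 / 16 + 9 / 32 * (η * s) * W) ≤ d * (27 / 16 * Real.log 2) := by
      apply mul_le_mul_of_nonneg_left _ (by positivity)
      have := Real.log_two_gt_d9
      linarith
    linarith
  have hsub : {ω | ∃ k : ℕ, K0 ≤ k ∧ (k : ℝ) ≤ K0 + 𝒯 / η ∧
      3 * ε / 8 ≤ ‖(uldNoise T (2 * s) η σ (fun n => ξ n ω) k).2‖} ⊆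
      ⋃ i ∈ Finset.range (J + 1), {ω | ∃ k, K0 + i * W ≤ k ∧ k ≤ K0 + i * W + W ∧
        c ≤ uldEn b lam s (uldNoise T (2 * s) η σ (fun n => ξ n ω) k)} := by
    rintro ω ⟨k, hk1, hk2, hk3⟩
    obtain ⟨n, rfl⟩ := Nat.exists_eq_add_of_le hk1
    push_cast at hk2
    have hn : n < (J + 1) * W := by
      have h1 : 𝒯 / η = 𝒯 * Sd * (1 / (η * Sd)) := by field_simp
      have h2 : 𝒯 * Sd * (1 / (η * Sd)) < (J + 1) * W := mul_lt_mul hJ2 hW1 (by positivity) (by positivity)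
      have : (n : ℝ) < (((J + 1) * W : ℕ) : ℝ) := by push_cast; linarith
      exact_mod_cast this
    simp only [Set.mem_iUnion, Finset.mem_range]
    refine ⟨n / W, Nat.div_lt_of_lt_mul (by rwa [mul_comm] at hn), K0 + n, ?_, ?_, ?_⟩
    · have := Nat.div_mul_le_self n W; omega
    · have := Nat.lt_div_mul_add (a := n) hWpos; omega
    · refine le_trans ?_ (uld_En_nonneg b lam s hl _)
      have h2 := pow_le_pow_left₀ (by positivity) hk3 2
      have h3 := mul_le_mul_of_nonneg_left h2 (show 0 ≤ 3 / 4 * s ^ 2 by positivity)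
      rw [hc]; refine le_trans (le_of_eq ?_) h3; ring
  refine (measure_mono hsub).trans ((measure_biUnion_finset_le _ _).trans ?_)
  refine (Finset.sum_le_sum fun i _ => (uld_block b lam T P ξ hξmeas hξindep hξ hT s η β σ hs hη hβ hh hσ hl hl2
    (K0 + i * W) W c).trans (ENNReal.ofReal_le_ofReal hexp)).trans ?_
  rw [Finset.sum_const, Finset.card_range, nsmul_eq_mul, ← ENNReal.ofReal_natCast,
    ← ENNReal.ofReal_mul (by positivity)]
  apply ENNReal.ofReal_le_ofReal
  have : 0 < Sd * 𝒯 := by positivity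
  push_cast
  rw [mul_div_assoc', div_le_iff₀ (by positivity), mul_comm]
  apply mul_le_mul_of_nonneg_left _ hδ.le
  linarith

end

lemma uld_rem {E : Type*} [NormedAddCommGroup E] [NormedSpace ℝ E] (G : E → E) (hG : Differentiable ℝ G) (L : ℝ)
    (hH : ∀ x y, ‖fderiv ℝ G x - fderiv ℝ G y‖ ≤ L * ‖x - y‖) (x y : E) :
    ‖G (x + y) - G x - fderiv ℝ G x y‖ ≤ L / 2 * ‖y‖ ^ 2 := by
  have hd : ∀ t : ℝ, HasDerivAt (fun t : ℝ => G (x + t • y) - G x - t • fderiv ℝ G x y)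
      (fderiv ℝ G (x + t • y) y - fderiv ℝ G x y) t := by
    intro t
    have h1 : HasDerivAt (fun t : ℝ => x + t • y) y t := by
      simpa using ((hasDerivAt_id t).smul_const y).const_add x
    have h2 := ((hG (x + t • y)).hasFDerivAt).comp_hasDerivAt t h1
    have h3 : HasDerivAt (fun t : ℝ => t • fderiv ℝ G x y) (fderiv ℝ G x y) t := by
      simpa using (hasDerivAt_id t).smul_const (fderiv ℝ G x y)
    exact (h2.sub_const (G x)).sub h3
  have hB : ∀ t : ℝ, HasDerivAt (fun t : ℝ => L / 2 * ‖y‖ ^ 2 * t ^ 2) (L * ‖y‖ ^ 2 * t) t := by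
    intro t
    have := (hasDerivAt_pow 2 t).const_mul (L / 2 * ‖y‖ ^ 2)
    refine this.congr_deriv ?_
    push_cast; ring
  have := image_norm_le_of_norm_deriv_right_le_deriv_boundary (a := 0) (b := 1)
    (f := fun t : ℝ => G (x + t • y) - G x - t • fderiv ℝ G x y)
    (f' := fun t => fderiv ℝ G (x + t • y) y - fderiv ℝ G x y)
    (B := fun t => L / 2 * ‖y‖ ^ 2 * t ^ 2) (B' := fun t => L * ‖y‖ ^ 2 * t)
    (fun t _ => (hd t).continuousAt.continuousWithinAt) (fun t _ => (hd t).hasDerivWithinAt)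
    (by simp) hB (by
      intro t ht
      rw [← ContinuousLinearMap.sub_apply]
      refine (ContinuousLinearMap.le_opNorm _ _).trans ?_
      have h1 := hH (x + t • y) x
      have h2 : ‖x + t • y - x‖ = t * ‖y‖ := by
        rw [add_sub_cancel_left, norm_smul, Real.norm_of_nonneg ht.1]
      rw [h2] at h1
      calc _ ≤ L * (t * ‖y‖) * ‖y‖ := by gcongr
        _ = _ := by ring) (x := 1) (by simp)
  simpa using this

lemma uld_scal (h p q : ℝ) (hp : (1 - h) ^ 2 ≤ p) (hq0 : 0 ≤ q) (hpq : p ≤ q ^ 2) (a : ℕ → ℝ)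
    (ha : ∀ n, a (n + 2) = 2 * (1 - h) * a (n + 1) - p * a n) :
    (a 0 = 0 → ∀ n : ℕ, |a n| ≤ n * q ^ (n - 1) * |a 1|) ∧
    (a 1 = (1 - h) * a 0 → ∀ n : ℕ, |a n| ≤ q ^ n * |a 0|) := by
  set z : ℂ := ⟨1 - h, Real.sqrt (p - (1 - h) ^ 2)⟩ with hz
  have hzz : z + (starRingEnd ℂ) z = ((2 * (1 - h) : ℝ) : ℂ) := by
    apply Complex.ext <;> simp [hz]; ring
  have hnsq : Complex.normSq z = p := by
    rw [Complex.normSq_apply, hz]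
    simp only
    rw [Real.mul_self_sqrt (by linarith)]; ring
  have hzp : z * (starRingEnd ℂ) z = (p : ℂ) := by
    rw [Complex.mul_conj, hnsq]
  have hzn : ‖z‖ ≤ q := by
    rw [← Real.sqrt_sq (norm_nonneg z), ← Complex.normSq_eq_norm_sq, hnsq]
    exact Real.sqrt_le_iff.2 ⟨hq0, hpq⟩
  have hac : ∀ n, (a (n + 2) : ℂ) = (z + (starRingEnd ℂ) z) * a (n + 1) - (z * (starRingEnd ℂ) z) * a n := by
    intro n; rw [ha, hzz, hzp]; push_cast; ring
  constructor
  · intro h0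
    have key : ∀ n, (a (n + 1) : ℂ) = z * a n + (starRingEnd ℂ) z ^ n * a 1 := by
      intro n
      induction n with
      | zero => simp [h0]
      | succ n ih =>
        rw [hac, pow_succ]
        linear_combination (starRingEnd ℂ) z * ih
    intro n
    induction n with
    | zero => simp [h0]
    | succ n ih =>
      have h1 : |a (n + 1)| = ‖(a (n + 1) : ℂ)‖ := by simp
      rw [h1, key]
      refine (norm_add_le _ _).trans ?_
      rw [norm_mul, norm_mul, norm_pow, Complex.norm_conj]
      simp only [Complex.norm_real, Real.norm_eq_abs]
      have h2 : ‖z‖ * |a n| ≤ q * (n * q ^ (n - 1) * |a 1|) := by gcongr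
      have h3 : ‖z‖ ^ n * |a 1| ≤ q ^ n * |a 1| := by gcongr
      rcases n with _ | n
      · simp at *; linarith
      · simp only [Nat.add_sub_cancel] at *
        push_cast at *
        have : q * ((n + 1) * q ^ n * |a 1|) = (n + 1) * q ^ (n + 1) * |a 1| := by ring
        linarith
  · intro h0
    have key : ∀ n, (a n : ℂ) * 2 = (z ^ n + (starRingEnd ℂ) z ^ n) * a 0 ∧
        (a (n + 1) : ℂ) * 2 = (z ^ (n + 1) + (starRingEnd ℂ) z ^ (n + 1)) * a 0 := by
      intro n
      induction n with
      | zero =>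
        refine ⟨by simp; ring, ?_⟩
        simp only [zero_add, pow_one, hzz, h0]; push_cast; ring
      | succ n ih =>
        refine ⟨ih.2, ?_⟩
        rw [hac]
        linear_combination (z + (starRingEnd ℂ) z) * ih.2 - (z * (starRingEnd ℂ) z) * ih.1
    intro n
    have h1 : |a n| * 2 = ‖(a n : ℂ) * 2‖ := by simp
    have h2 : ‖(a n : ℂ) * 2‖ ≤ (q ^ n + q ^ n) * |a 0| := by
      rw [(key n).1, norm_mul]
      simp only [Complex.norm_real, Real.norm_eq_abs]
      gcongr
      refine (norm_add_le _ _).trans ?_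
      rw [norm_pow, norm_pow, Complex.norm_conj]
      gcongr
    linarith

/-- Two-step linear recursion in the position variable. -/
def uldSeq {E : Type*} [NormedAddCommGroup E] [NormedSpace ℝ E] (h : ℝ) (Γ : E →L[ℝ] E) (y0 y1 : E) : ℕ → E
  | 0 => y0
  | 1 => y1
  | n + 2 => (2 * (1 - h)) • uldSeq h Γ y0 y1 (n + 1) - Γ (uldSeq h Γ y0 y1 n)

lemma uld_duhamel {E : Type*} [NormedAddCommGroup E] [NormedSpace ℝ E] (h : ℝ) (Γ : E →L[ℝ] E)
    (D R : ℕ → E) (hD : ∀ n, D (n + 2) = (2 * (1 - h)) • D (n + 1) - Γ (D n) - R n) (n : ℕ) :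
    D n = uldSeq h Γ (D 0) ((1 - h) • D 0) n + uldSeq h Γ 0 (D 1 - (1 - h) • D 0) n
      - ∑ j ∈ Finset.range n, uldSeq h Γ 0 (R j) (n - 1 - j) := by
  have hS1 : ∀ n, ∑ j ∈ Finset.range (n + 1), uldSeq h Γ 0 (R j) (n + 1 - 1 - j) =
      ∑ j ∈ Finset.range n, uldSeq h Γ 0 (R j) ((n - 1 - j) + 1) := by
    intro n
    rw [Finset.sum_range_succ]
    simp only [Nat.add_sub_cancel, Nat.sub_self, uldSeq, add_zero]
    refine Finset.sum_congr rfl fun j hj => ?_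
    have := Finset.mem_range.1 hj
    congr 1; omega
  have hS2 : ∀ n, ∑ j ∈ Finset.range (n + 2), uldSeq h Γ 0 (R j) (n + 2 - 1 - j) =
      ∑ j ∈ Finset.range n, uldSeq h Γ 0 (R j) ((n - 1 - j) + 2) + R n := by
    intro n
    rw [Finset.sum_range_succ, Finset.sum_range_succ]
    have e1 : n + 2 - 1 - (n + 1) = 0 := by omega
    have e2 : n + 2 - 1 - n = 1 := by omega
    rw [e1, e2]
    simp only [uldSeq, add_zero]
    congr 1
    refine Finset.sum_congr rfl fun j hj => ?_
    have := Finset.mem_range.1 hj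
    have e3 : n + 2 - 1 - j = (n - 1 - j) + 2 := by omega
    rw [e3, uldSeq]
  suffices H : ∀ n, (D n = uldSeq h Γ (D 0) ((1 - h) • D 0) n + uldSeq h Γ 0 (D 1 - (1 - h) • D 0) n
      - ∑ j ∈ Finset.range n, uldSeq h Γ 0 (R j) (n - 1 - j)) ∧
    (D (n + 1) = uldSeq h Γ (D 0) ((1 - h) • D 0) (n + 1) + uldSeq h Γ 0 (D 1 - (1 - h) • D 0) (n + 1)
      - ∑ j ∈ Finset.range (n + 1), uldSeq h Γ 0 (R j) (n + 1 - 1 - j)) from (H n).1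
  intro n
  induction n with
  | zero => simp [uldSeq]
  | succ n ih =>
    refine ⟨ih.2, ?_⟩
    obtain ⟨i1, i2⟩ := ih
    rw [hS1] at i2
    rw [hD, hS2]
    simp only [uldSeq]
    rw [Finset.sum_sub_distrib, ← Finset.smul_sum, ← map_sum]
    rw [i2]
    conv_lhs => rw [i1]
    simp only [map_sub, map_add, smul_sub, smul_add]
    abel

section
variable {d : ℕ} (b : OrthonormalBasis (Fin d) ℝ (EuclideanSpace ℝ (Fin d))) (lam : Fin d → ℝ)
  (T : EuclideanSpace ℝ (Fin d) →L[ℝ] EuclideanSpace ℝ (Fin d))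

lemma uld_norm_lift (x y : EuclideanSpace ℝ (Fin d)) (κ : ℝ) (hκ : 0 ≤ κ)
    (H : ∀ i, |⟪b i, x⟫| ≤ κ * |⟪b i, y⟫|) : ‖x‖ ≤ κ * ‖y‖ := by
  apply le_of_sq_le_sq _ (by positivity)
  rw [mul_pow, uld_norm_sq b x, uld_norm_sq b y, Finset.mul_sum]
  refine Finset.sum_le_sum fun i _ => ?_
  have := pow_le_pow_left₀ (abs_nonneg _) (H i) 2
  rwa [mul_pow, sq_abs, sq_abs] at this

lemma uld_seq_bd (hT : ∀ i, T (b i) = lam i • b i) (s η q : ℝ)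
    (hl : ∀ i, s ^ 2 ≤ lam i) (hq0 : 0 ≤ q) (hq : ∀ i, 1 - 2 * (η * s) + η ^ 2 * lam i ≤ q ^ 2)
    (Γ : EuclideanSpace ℝ (Fin d) →L[ℝ] EuclideanSpace ℝ (Fin d))
    (hΓ : ∀ y, Γ y = (1 - 2 * (η * s)) • y + η ^ 2 • T y) (y : EuclideanSpace ℝ (Fin d)) (n : ℕ) :
    ‖uldSeq (η * s) Γ 0 y n‖ ≤ n * q ^ (n - 1) * ‖y‖ ∧
    ‖uldSeq (η * s) Γ y ((1 - η * s) • y) n‖ ≤ q ^ n * ‖y‖ := by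
  have hrec : ∀ y0 y1 i n, ⟪b i, uldSeq (η * s) Γ y0 y1 (n + 2)⟫ =
      2 * (1 - η * s) * ⟪b i, uldSeq (η * s) Γ y0 y1 (n + 1)⟫ -
      (1 - 2 * (η * s) + η ^ 2 * lam i) * ⟪b i, uldSeq (η * s) Γ y0 y1 n⟫ := by
    intro y0 y1 i n
    rw [uldSeq, hΓ]
    simp only [inner_add_right, inner_sub_right, inner_smul_right, uld_inner_T b lam T hT]
    ring
  have hp : ∀ i, (1 - η * s) ^ 2 ≤ 1 - 2 * (η * s) + η ^ 2 * lam i := by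
    intro i
    have := mul_le_mul_of_nonneg_left (hl i) (sq_nonneg η)
    nlinarith
  constructor
  · refine uld_norm_lift b _ _ _ (by positivity) fun i => ?_
    have := (uld_scal (η * s) _ q (hp i) hq0 (hq i) (fun n => ⟪b i, uldSeq (η * s) Γ 0 y n⟫)
      (hrec 0 y i)).1 (by simp [uldSeq]) n
    simpa [uldSeq] using this
  · refine uld_norm_lift b _ _ _ (by positivity) fun i => ?_
    have := (uld_scal (η * s) _ q (hp i) hq0 (hq i) (fun n => ⟪b i, uldSeq (η * s) Γ y ((1 - η * s) • y) n⟫)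
      (hrec _ _ i)).2 (by simp [uldSeq, inner_smul_right]) n
    simpa [uldSeq] using this

/-- Deterministic perturbation bound. -/
lemma uld_pert (hT : ∀ i, T (b i) = lam i • b i) (s η q : ℝ) (hη : 0 < η) (hs : 0 < s)
    (hl : ∀ i, s ^ 2 ≤ lam i) (hq0 : 0 ≤ q) (hq : ∀ i, 1 - 2 * (η * s) + η ^ 2 * lam i ≤ q ^ 2)
    (V Y g w : ℕ → EuclideanSpace ℝ (Fin d)) (σ : ℝ)
    (hV : ∀ k, V (k + 1) = V k - η • ((2 * s) • V k + g k) + σ • w k)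
    (hY : ∀ k, Y (k + 1) = Y k + η • V k) (n : ℕ) :
    ‖Y n‖ ≤ ‖(uldNoise T (2 * s) η σ w n).2‖ + (q ^ n * ‖Y 0‖ + n * q ^ (n - 1) * (‖Y 1 - Y 0‖ + η * s * ‖Y 0‖))
      + η ^ 2 * ∑ j ∈ Finset.range n, (n - 1 - j : ℕ) * q ^ (n - 1 - j - 1) * ‖g j - T (Y j)‖ := by
  set Γ : EuclideanSpace ℝ (Fin d) →L[ℝ] EuclideanSpace ℝ (Fin d) :=
    (1 - 2 * (η * s)) • ContinuousLinearMap.id ℝ _ + η ^ 2 • T with hΓdef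
  have hΓ : ∀ y, Γ y = (1 - 2 * (η * s)) • y + η ^ 2 • T y := fun y => by simp [hΓdef]
  set S := uldNoise T (2 * s) η σ w with hS
  have hS0 : S 0 = (0, 0) := rfl
  have hS1 : ∀ k, (S (k + 1)).1 = (S k).1 - η • ((2 * s) • (S k).1 + T (S k).2) + σ • w k := fun k => rfl
  have hS2 : ∀ k, (S (k + 1)).2 = (S k).2 + η • (S k).1 := fun k => rfl
  set D : ℕ → EuclideanSpace ℝ (Fin d) := fun k => Y k - (S k).2 with hDdef
  have hD : ∀ n, D (n + 2) = (2 * (1 - η * s)) • D (n + 1) - Γ (D n) - η ^ 2 • (g n - T (Y n)) := by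
    intro n
    simp only [hDdef, hΓ, hY, hS2, hV, hS1, map_sub]
    module
  have hdu := uld_duhamel (η * s) Γ D (fun n => η ^ 2 • (g n - T (Y n))) hD n
  have hD0 : D 0 = Y 0 := by simp [hDdef, hS0]
  have hD1 : D 1 = Y 1 := by simp [hDdef, hS2 0, hS0]
  rw [hD0, hD1] at hdu
  have hbd := uld_seq_bd b lam T hT s η q hl hq0 hq Γ hΓ
  have hn : ‖D n‖ ≤ q ^ n * ‖Y 0‖ + n * q ^ (n - 1) * (‖Y 1 - Y 0‖ + η * s * ‖Y 0‖)
      + η ^ 2 * ∑ j ∈ Finset.range n, (n - 1 - j : ℕ) * q ^ (n - 1 - j - 1) * ‖g j - T (Y j)‖ := by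
    rw [hdu]
    refine (norm_sub_le _ _).trans (add_le_add ((norm_add_le _ _).trans (add_le_add (hbd _ n).2 ?_)) ?_)
    · refine (hbd _ n).1.trans ?_
      gcongr
      have e : Y 1 - (1 - η * s) • Y 0 = (Y 1 - Y 0) + (η * s) • Y 0 := by module
      rw [e]
      refine (norm_add_le _ _).trans ?_
      rw [norm_smul, Real.norm_of_nonneg (by positivity)]
    · refine (norm_sum_le _ _).trans ?_
      rw [Finset.mul_sum]
      refine Finset.sum_le_sum fun j _ => ?_
      refine (hbd _ _).1.trans ?_
      rw [norm_smul, Real.norm_of_nonneg (by positivity)]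
      apply le_of_eq; ring
  have : Y n = (S n).2 + D n := by simp [hDdef]
  rw [this]
  refine (norm_add_le _ _).trans ?_
  linarith

end

lemma uld_sum1 (q : ℝ) (hq0 : 0 ≤ q) (hq1 : q < 1) (n : ℕ) :
    ∑ j ∈ Finset.range n, ((n - 1 - j : ℕ) : ℝ) * q ^ (n - 1 - j - 1) ≤ 1 / (1 - q) ^ 2 := by
  rw [Finset.sum_range_reflect (fun i => (i : ℝ) * q ^ (i - 1)) n]
  rw [le_div_iff₀ (by have : 0 < 1 - q := by linarith
                      positivity)]
  rcases n with _ | n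
  · simp
  rw [Finset.sum_range_succ']
  simp only [Nat.add_sub_cancel, Nat.cast_zero, zero_mul, add_zero]
  have : (∑ i ∈ Finset.range n, ((i + 1 : ℕ) : ℝ) * q ^ i) * (1 - q) ^ 2 = 1 - (n + 1) * q ^ n + n * q ^ (n + 1) := by
    induction n with
    | zero => simp
    | succ n ih =>
      rw [Finset.sum_range_succ, add_mul, ih]; push_cast; ring
  rw [this]
  have h1 : q ^ (n + 1) ≤ q ^ n := pow_le_pow_of_le_one hq0 hq1.le (by omega)
  have h2 := mul_le_mul_of_nonneg_left h1 (Nat.cast_nonneg (α := ℝ) n)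
  have h3 : 0 ≤ q ^ n := by positivity
  linarith

lemma uld_sum2 (q e : ℝ) (he : 0 < e) (heq : e ≤ q) (he1 : e < 1) (n : ℕ) :
    ∑ j ∈ Finset.range n, ((n - 1 - j : ℕ) : ℝ) * q ^ (n - 1 - j - 1) * (e ^ 2) ^ j ≤ n * (q ^ n / q ^ 2) / (1 - e) := by
  have hq : 0 < q := by linarith
  have h1 : ∀ j ∈ Finset.range n, ((n - 1 - j : ℕ) : ℝ) * q ^ (n - 1 - j - 1) * (e ^ 2) ^ j ≤ n * (q ^ n / q ^ 2) * e ^ j := by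
    intro j hj
    rcases Nat.eq_zero_or_pos (n - 1 - j) with h | h
    · rw [h]; simp; positivity
    obtain ⟨i, hi⟩ : ∃ i, n = i + j + 2 := ⟨n - j - 2, by omega⟩
    have e1 : n - 1 - j = i + 1 := by omega
    have e2 : q ^ n / q ^ 2 = q ^ i * q ^ j := by rw [hi]; field_simp; ring
    rw [e1, e2]
    simp only [Nat.add_sub_cancel]
    have e3 : (e ^ 2) ^ j = e ^ j * e ^ j := by rw [← pow_mul, ← pow_add]; congr 1; ring
    rw [e3]
    have h2 : e ^ j ≤ q ^ j := pow_le_pow_left₀ he.le heq j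
    have h3 : ((i + 1 : ℕ) : ℝ) ≤ n := by exact_mod_cast (by omega : i + 1 ≤ n)
    calc ((i + 1 : ℕ) : ℝ) * q ^ i * (e ^ j * e ^ j) ≤ n * q ^ i * (q ^ j * e ^ j) := by gcongr
      _ = _ := by ring
  refine (Finset.sum_le_sum h1).trans ?_
  rw [← Finset.mul_sum]
  have h4 : ∑ j ∈ Finset.range n, e ^ j ≤ 1 / (1 - e) := by
    have := geom_sum_mul e n
    rw [le_div_iff₀ (by linarith)]
    have : 0 < e ^ n := by positivity
    linarith
  refine (mul_le_mul_of_nonneg_left h4 (by positivity)).trans (le_of_eq ?_)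
  ring

/-- Elementary bounds on the contraction factor. -/
lemma uld_q (s η M q : ℝ) (hs : 0 < s) (hη : 0 < η) (hM : 0 < M) (hh : η * s ≤ 1 / 12) (hMs : η * M ≤ s / 12)
    (hq : q = Real.exp (-(η * s) + η ^ 2 * M / 2)) :
    0 < q ∧ q < 1 ∧ Real.exp (-(η * s)) ≤ q ∧ 11 / 12 ≤ q ∧ q ≤ Real.exp (-(23 / 24 * (η * s))) ∧
    η ^ 2 * (1 / (1 - q) ^ 2) ≤ 32 / 25 / s ^ 2 ∧ 12 / 13 * (η * s) ≤ 1 - Real.exp (-(η * s)) ∧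
    1 - 2 * (η * s) + η ^ 2 * M ≤ q ^ 2 := by
  have hhp : 0 < η * s := by positivity
  have hq0 : 0 < q := by rw [hq]; positivity
  have h1 : η ^ 2 * M / 2 ≤ η * s / 24 := by nlinarith
  have h2 : Real.exp (-(η * s)) ≤ q := by
    rw [hq]; apply Real.exp_le_exp.2; have : 0 ≤ η ^ 2 * M / 2 := by positivity
    linarith
  have h3 : q ≤ Real.exp (-(23 / 24 * (η * s))) := by
    rw [hq]; apply Real.exp_le_exp.2; linarith
  have h4 : ∀ x : ℝ, 0 ≤ x → x ≤ 1 / 12 → 12 / 13 * x ≤ 1 - Real.exp (-x) := by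
    intro x hx hx2
    have e1 := Real.add_one_le_exp x
    have e2 : Real.exp (-x) ≤ 1 / (1 + x) := by
      rw [Real.exp_neg, inv_eq_one_div]; apply one_div_le_one_div_of_le <;> linarith
    have e3 : 1 / (1 + x) ≤ 1 - 12 / 13 * x := by
      rw [div_le_iff₀ (by linarith)]; nlinarith
    linarith
  have h5 := h4 (23 / 24 * (η * s)) (by positivity) (by linarith)
  have h6 : 23 / 26 * (η * s) ≤ 1 - q := by linarith
  refine ⟨hq0, by nlinarith, h2, ?_, h3, ?_, h4 _ hhp.le hh, ?_⟩
  · have := Real.add_one_le_exp (-(η * s)); linarith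
  · rw [mul_one_div, div_le_div_iff₀ (by have : 0 < 1 - q := by nlinarith
                                         positivity) (by positivity)]
    have := pow_le_pow_left₀ (by positivity) h6 2
    nlinarith [this]
  · have := Real.add_one_le_exp (-(2 * (η * s)) + η ^ 2 * M)
    rw [hq, ← Real.exp_nat_mul]
    have e : ((2 : ℕ) : ℝ) * (-(η * s) + η ^ 2 * M / 2) = -(2 * (η * s)) + η ^ 2 * M := by push_cast; ring
    rw [e]; linarith

set_option maxHeartbeats 2000000 in
lemma uld_caseA (s η M q τ ε r W L : ℝ) (n : ℕ) (hs : 0 < s) (hη : 0 < η) (hM : 0 < M)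
    (hh : η * s ≤ 1 / 12) (hMs : η * M ≤ s / 12)
    (hq : q = Real.exp (-(η * s) + η ^ 2 * M / 2)) (hε : 0 < ε) (hr : 0 < r) (hW : 1 ≤ W) (hL : 0 < L)
    (hτ : 1 ≤ s * τ) (hcase : η * M * τ ≤ 1) (hn : τ ≤ n * η)
    (hτe : τ * Real.exp (-s * τ) = ε ^ 2 / (8 * r ^ 2 * W))
    (hA1 : 6 * (s * ε) ^ 2 ≤ (r * W) ^ 2) (hL1 : 4 * (L * ε) ≤ s ^ 2) (hL2 : 12 * (L * ε) ≤ s) :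
    q ^ n * r + n * q ^ (n - 1) * (η * s * r) + (L * ε ^ 2 * (32 / 25 / s ^ 2) +
      L * r ^ 2 * (η ^ 2 * (n * (q ^ n / q ^ 2) / (1 - Real.exp (-(η * s)))))) ≤ 5 * ε / 8 := by
  obtain ⟨hq0, hq1, -, hq2, hq3, -, he, -⟩ := uld_q s η M q hs hη hM hh hMs hq
  have hhp : 0 < η * s := by positivity
  have hτ0 : 0 < τ := by
    by_contra hc; push Not at hc; nlinarith
  obtain ⟨t, ht⟩ : ∃ t, t = n * η := ⟨_, rfl⟩
  rw [← ht] at hn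
  have ht0 : 0 < t := by linarith
  have hn0 : n ≠ 0 := by rintro rfl; simp at ht; linarith
  obtain ⟨a, ha⟩ : ∃ a, a = s - η * M / 2 := ⟨_, rfl⟩
  have ha1 : 23 / 24 * s ≤ a := by rw [ha]; linarith
  have hqn : q ^ n = Real.exp (-(a * t)) := by
    rw [hq, ← Real.exp_nat_mul, ha, ht]; congr 1; ring
  have hF : t * q ^ n ≤ 173 / 100 * (ε ^ 2 / (8 * r ^ 2 * W)) := by
    have h1 := Real.add_one_le_exp (a * (t - τ))
    have h2 : 23 / 24 ≤ a * τ := by nlinarith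
    have h3 : 23 / 24 * t ≤ τ * Real.exp (a * (t - τ)) := by
      have : τ * (a * (t - τ) + 1) ≤ τ * Real.exp (a * (t - τ)) := by gcongr
      nlinarith
    have h4 : t * Real.exp (-(a * t)) ≤ 24 / 23 * (τ * Real.exp (-(a * τ))) := by
      have e : Real.exp (-(a * τ)) = Real.exp (a * (t - τ)) * Real.exp (-(a * t)) := by
        rw [← Real.exp_add]; congr 1; ring
      rw [e]
      have := mul_le_mul_of_nonneg_right h3 (Real.exp_pos (-(a * t))).le
      linarith
    have h5 : Real.exp (-(a * τ)) ≤ 33 / 20 * Real.exp (-s * τ) := by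
      have e : -(a * τ) = η * M * τ / 2 + -s * τ := by rw [ha]; ring
      rw [e, Real.exp_add]
      gcongr
      have h6 : Real.exp (η * M * τ / 2) ≤ Real.exp (1 / 2) := Real.exp_le_exp.2 (by linarith)
      refine h6.trans ?_
      have h7 : Real.exp (1 / 2) ^ 2 = Real.exp 1 := by
        rw [← Real.exp_nat_mul]; norm_num
      have h8 := Real.exp_one_lt_d9
      apply le_of_sq_le_sq _ (by norm_num)
      rw [h7]; norm_num; linarith
    rw [hqn, ← hτe]
    have h9 := mul_le_mul_of_nonneg_left h5 hτ0.le
    have : 0 < τ * Real.exp (-s * τ) := by positivity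
    linarith
  have hqn0 : 0 < q ^ n := by positivity
  have hqn1 : q ^ (n - 1) = q ^ n / q := by
    obtain ⟨k, rfl⟩ := Nat.exists_eq_succ_of_ne_zero hn0
    simp only [Nat.succ_eq_add_one, Nat.add_sub_cancel]; field_simp; ring
  obtain ⟨G, hG⟩ : ∃ G, G = t * q ^ n := ⟨_, rfl⟩
  rw [← hG] at hF
  have hG0 : 0 < G := by rw [hG]; positivity
  have hqi : 1 / q ≤ 12 / 11 := by
    rw [div_le_iff₀ hq0]; linarith
  have hT1 : q ^ n * r ≤ s * r * G := by
    have h1 : 1 ≤ s * t := hτ.trans (mul_le_mul_of_nonneg_left hn hs.le)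
    have h0 : 0 < q ^ n * r := by positivity
    have h2 := mul_le_mul_of_nonneg_right h1 h0.le
    have e : s * r * G = s * t * (q ^ n * r) := by rw [hG]; ring
    rw [e]; linarith
  have hT2 : n * q ^ (n - 1) * (η * s * r) ≤ 12 / 11 * (s * r * G) := by
    have e : n * q ^ (n - 1) * (η * s * r) = 1 / q * (s * r * G) := by
      rw [hqn1, hG, ht]; field_simp
    rw [e]; gcongr
  have hT3 : L * r ^ 2 * (η ^ 2 * (n * (q ^ n / q ^ 2) / (1 - Real.exp (-(η * s))))) ≤
      13 / 10 * (L * r ^ 2 * G / s) := by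
    have e1 : η ^ 2 * (n * (q ^ n / q ^ 2) / (1 - Real.exp (-(η * s)))) =
        η * G * (1 / q) ^ 2 * (1 / (1 - Real.exp (-(η * s)))) := by
      rw [hG, ht]; field_simp
    have e2 : 1 / (1 - Real.exp (-(η * s))) ≤ 13 / 12 * (1 / (η * s)) := by
      have : 13 / 12 * (1 / (η * s)) = 1 / (12 / 13 * (η * s)) := by field_simp
      rw [this]
      exact one_div_le_one_div_of_le (by positivity) he
    have e3 : 0 ≤ 1 / (1 - Real.exp (-(η * s))) := by
      have : 0 < 1 - Real.exp (-(η * s)) := by linarith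
      positivity
    rw [e1]
    calc L * r ^ 2 * (η * G * (1 / q) ^ 2 * (1 / (1 - Real.exp (-(η * s)))))
        ≤ L * r ^ 2 * (η * G * (12 / 11) ^ 2 * (13 / 12 * (1 / (η * s)))) := by gcongr
      _ = (12 / 11) ^ 2 * (13 / 12) * (L * r ^ 2 * G / s) := by field_simp
      _ ≤ _ := by
        have : 0 < L * r ^ 2 * G / s := by positivity
        nlinarith
  have hW0 : 0 < W := by linarith
  have hrG : r * G ≤ 173 / 800 * (ε ^ 2 / (r * W)) := by
    have := mul_le_mul_of_nonneg_left hF hr.le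
    refine this.trans (le_of_eq ?_)
    field_simp; ring
  have hsr : s * r * G ≤ 89 / 1000 * ε := by
    have h1 : s * ε ≤ 41 / 100 * (r * W) := by
      apply le_of_sq_le_sq _ (by positivity)
      nlinarith [sq_nonneg (r * W)]
    have h2 : s * (ε ^ 2 / (r * W)) ≤ 41 / 100 * ε := by
      rw [mul_div_assoc', div_le_iff₀ (by positivity)]
      nlinarith
    have h3 := mul_le_mul_of_nonneg_left hrG hs.le
    nlinarith
  have hLr : L * r ^ 2 * G / s ≤ 2 / 100 * ε := by
    have h1 : r ^ 2 * G ≤ 173 / 800 * ε ^ 2 := by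
      have := mul_le_mul_of_nonneg_left hrG hr.le
      have e : r * (173 / 800 * (ε ^ 2 / (r * W))) = 173 / 800 * ε ^ 2 / W := by field_simp
      rw [e] at this
      have h2 : 173 / 800 * ε ^ 2 / W ≤ 173 / 800 * ε ^ 2 := div_le_self (by positivity) hW
      nlinarith
    rw [div_le_iff₀ hs]
    have h2 := mul_le_mul_of_nonneg_left h1 hL.le
    have h3 := mul_le_mul_of_nonneg_right hL2 hε.le
    nlinarith
  have hLe : L * ε ^ 2 * (32 / 25 / s ^ 2) ≤ 32 / 100 * ε := by
    rw [mul_div_assoc', div_le_iff₀ (by positivity)]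
    nlinarith
  linarith

set_option maxHeartbeats 2000000 in
lemma uld_caseB (s η M q τ ε L y0 y1 : ℝ) (k : ℕ) (hs : 0 < s) (hη : 0 < η) (hM : 0 < M)
    (hh : η * s ≤ 1 / 12) (hMs : η * M ≤ s / 12) (hη1 : η ≤ 1)
    (hq : q = Real.exp (-(η * s) + η ^ 2 * M / 2)) (hε : 0 < ε) (hL : 0 < L) (hτ0 : 0 < τ)
    (hcase : 1 < η * M * τ) (hE1 : η * M ^ 2 * τ ≤ s / 144) (hE2 : η * M ^ 3 * τ ≤ s ^ 3 / 36)
    (hk : τ / 2 - η ≤ k * η) (hL1 : 4 * (L * ε) ≤ s ^ 2) (hy0 : 0 ≤ y0) (hy1 : y0 ≤ 3 / 2 * ε)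
    (hy2 : 0 ≤ y1) (hy3 : y1 ≤ 3 * ε) :
    q ^ k * y0 + k * q ^ (k - 1) * (y1 + η * s * y0) + L * ε ^ 2 * (32 / 25 / s ^ 2) ≤ 5 * ε / 8 := by
  obtain ⟨hq0, hq1, -, hq2, hq3, -, -, -⟩ := uld_q s η M q hs hη hM hh hMs hq
  have hhp : 0 < η * s := by positivity
  have hM1 : M ≤ s / 144 := by
    have : M * 1 ≤ M * (η * M * τ) := by gcongr
    nlinarith
  have hM2 : M ^ 2 ≤ s ^ 3 / 36 := by
    have : M ^ 2 * 1 ≤ M ^ 2 * (η * M * τ) := by gcongr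
    nlinarith
  have hMτ : 1 < M * τ := by
    have : η * (M * τ) ≤ 1 * (M * τ) := by gcongr
    linarith
  obtain ⟨u, hu⟩ : ∃ u, u = s * τ := ⟨_, rfl⟩
  have hu1 : 144 ≤ u := by rw [hu]; nlinarith
  have hu2 : 36 ≤ η * s * u ^ 2 := by
    have h1 : η * τ ^ 2 * (36 * M ^ 2) ≤ η * τ ^ 2 * s ^ 3 := by
      gcongr; linarith
    have h2 : 1 * 1 ≤ (η * M * τ) * (M * τ) := mul_le_mul hcase.le hMτ.le (by norm_num) (by positivity)
    rw [hu]; nlinarith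
  obtain ⟨x, hx⟩ : ∃ x, x = η * s * k := ⟨_, rfl⟩
  have hx1 : 49 / 100 * u ≤ x := by
    have : s * (τ / 2 - η) ≤ s * (k * η) := by gcongr
    rw [hx]; nlinarith
  have hx2 : 70 ≤ x := by linarith
  have hk0 : k ≠ 0 := by rintro rfl; simp at hx; linarith
  have hqk1 : q ^ (k - 1) = q ^ k / q := by
    obtain ⟨j, rfl⟩ := Nat.exists_eq_succ_of_ne_zero hk0
    simp only [Nat.succ_eq_add_one, Nat.add_sub_cancel]; field_simp; ring
  have hkx : k ≤ x ^ 3 / 8 := by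
    have h1 : (k : ℝ) * 36 ≤ k * (η * s * u ^ 2) := by gcongr
    have h2 : (k : ℝ) * (η * s * u ^ 2) = x * u ^ 2 := by rw [hx]; ring
    have h3 : u ^ 2 ≤ (100 / 49 * x) ^ 2 := by gcongr; linarith
    have h4 : x * u ^ 2 ≤ x * (100 / 49 * x) ^ 2 := by gcongr
    have h5 : 0 < x ^ 3 := by positivity
    nlinarith
  have hqk : q ^ k ≤ Real.exp (-(23 / 24 * x)) := by
    have := pow_le_pow_left₀ hq0.le hq3 k
    rw [← Real.exp_nat_mul] at this
    refine this.trans (le_of_eq ?_)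
    rw [hx]; congr 1; ring
  have hqk2 : q ^ k * (x ^ 5 / 150) ≤ 1 := by
    have h1 := Real.pow_div_factorial_le_exp (23 / 24 * x) (by positivity) 5
    have h2 : x ^ 5 / 150 ≤ Real.exp (23 / 24 * x) := by
      refine le_trans ?_ h1
      have : 0 < x ^ 5 := by positivity
      rw [mul_pow]
      norm_num [Nat.factorial]
      nlinarith
    calc q ^ k * (x ^ 5 / 150) ≤ Real.exp (-(23 / 24 * x)) * Real.exp (23 / 24 * x) := by gcongr
      _ = 1 := by rw [← Real.exp_add]; simp
  have hqi : 1 / q ≤ 12 / 11 := by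
    rw [div_le_iff₀ hq0]; linarith
  have hkq : k * q ^ (k - 1) ≤ 1 / 50 := by
    have hqk0 : 0 < q ^ k := by positivity
    have h1 : k * q ^ (k - 1) ≤ (x ^ 3 / 8) * q ^ k * (12 / 11) := by
      rw [hqk1]
      have : k * (q ^ k / q) = k * q ^ k * (1 / q) := by ring
      rw [this]; gcongr
    have h2 : x ^ 3 * q ^ k * 4900 ≤ 150 := by
      have h3 : (4900 : ℝ) ≤ x ^ 2 := by
        have := pow_le_pow_left₀ (by norm_num) hx2 2
        linarith
      have h4 : x ^ 3 * q ^ k * 4900 ≤ x ^ 3 * q ^ k * x ^ 2 := mul_le_mul_of_nonneg_left h3 (by positivity)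
      have e : x ^ 3 * q ^ k * x ^ 2 = 150 * (q ^ k * (x ^ 5 / 150)) := by ring
      linarith
    linarith
  have hqk3 : q ^ k ≤ 1 / 50 := by
    have h1 : q ^ k ≤ q ^ (k - 1) := pow_le_pow_of_le_one hq0.le hq1.le (by omega)
    have h2 : (1 : ℝ) ≤ k := by exact_mod_cast Nat.one_le_iff_ne_zero.2 hk0
    have h3 : 0 < q ^ (k - 1) := by positivity
    nlinarith
  have hLe : L * ε ^ 2 * (32 / 25 / s ^ 2) ≤ 32 / 100 * ε := by
    rw [mul_div_assoc', div_le_iff₀ (by positivity)]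
    nlinarith
  have h1 : q ^ k * y0 ≤ 1 / 50 * (3 / 2 * ε) := by gcongr
  have h2 : k * q ^ (k - 1) * (y1 + η * s * y0) ≤ 1 / 50 * (3 * ε + 1 / 12 * (3 / 2 * ε)) := by gcongr
  linarith

section
variable {d : ℕ} (b : OrthonormalBasis (Fin d) ℝ (EuclideanSpace ℝ (Fin d))) (lam : Fin d → ℝ)
  (T : EuclideanSpace ℝ (Fin d) →L[ℝ] EuclideanSpace ℝ (Fin d))

lemma uld_det_A (hT : ∀ i, T (b i) = lam i • b i) (s η M τ Tesc ε r W L σ : ℝ) (hs : 0 < s) (hη : 0 < η) (hM : 0 < M)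
    (hl : ∀ i, s ^ 2 ≤ lam i) (hlM : ∀ i, lam i ≤ M)
    (hh : η * s ≤ 1 / 12) (hMs : η * M ≤ s / 12) (hε : 0 < ε) (hr : 0 < r) (hW : 1 ≤ W) (hL : 0 < L)
    (hτ : 1 ≤ s * τ) (hcase : η * M * τ ≤ 1)
    (hτe : τ * Real.exp (-s * τ) = ε ^ 2 / (8 * r ^ 2 * W))
    (hA1 : 6 * (s * ε) ^ 2 ≤ (r * W) ^ 2) (hL1 : 4 * (L * ε) ≤ s ^ 2) (hL2 : 12 * (L * ε) ≤ s)
    (V Y g w : ℕ → EuclideanSpace ℝ (Fin d))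
    (hV : ∀ k, V (k + 1) = V k - η • ((2 * s) • V k + g k) + σ • w k)
    (hY : ∀ k, Y (k + 1) = Y k + η • V k) (hV0 : V 0 = 0) (hY0 : ‖Y 0‖ ≤ r)
    (hg : ∀ k, ‖g k - T (Y k)‖ ≤ L / 2 * ‖Y k‖ ^ 2)
    (hfirst : ∀ k : ℕ, k * η ≤ τ → ‖Y k‖ ≤ ε + r * Real.exp (-s * (k * η)))
    (hnoise : ∀ k : ℕ, τ ≤ k * η → k * η ≤ Tesc → ‖(uldNoise T (2 * s) η σ w k).2‖ ≤ 3 * ε / 8) (n : ℕ) :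
    n * η ≤ Tesc → ‖Y n‖ ≤ ε + r * Real.exp (-s * (n * η)) := by
  induction n using Nat.strong_induction_on with
  | _ n ih =>
  intro hn
  rcases le_total (n * η) τ with hnτ | hnτ
  · exact hfirst n hnτ
  obtain ⟨q, hq⟩ : ∃ q, q = Real.exp (-(η * s) + η ^ 2 * M / 2) := ⟨_, rfl⟩
  obtain ⟨hq0, hq1, hqe, hq2, hq3, hqs, he, hqM⟩ := uld_q s η M q hs hη hM hh hMs hq
  have hA := uld_caseA s η M q τ ε r W L n hs hη hM hh hMs hq hε hr hW hL hτ hcase hnτ hτe hA1 hL1 hL2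
  have hp := uld_pert b lam T hT s η q hη hs hl hq0.le
    (fun i => le_trans (by have := mul_le_mul_of_nonneg_left (hlM i) (sq_nonneg η); linarith) hqM) V Y g w σ hV hY n
  have hY1 : ‖Y 1 - Y 0‖ = 0 := by rw [hY 0, hV0]; simp
  rw [hY1, zero_add] at hp
  obtain ⟨e, hedef⟩ : ∃ e, e = Real.exp (-(η * s)) := ⟨_, rfl⟩
  rw [← hedef] at hqe he hA
  have he0 : 0 < e := by rw [hedef]; positivity
  have hhp : 0 < η * s := by positivity
  have hb : ∀ j ∈ Finset.range n, ((n - 1 - j : ℕ) : ℝ) * q ^ (n - 1 - j - 1) * ‖g j - T (Y j)‖ ≤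
      L * ε ^ 2 * (((n - 1 - j : ℕ) : ℝ) * q ^ (n - 1 - j - 1)) +
      L * r ^ 2 * (((n - 1 - j : ℕ) : ℝ) * q ^ (n - 1 - j - 1) * (e ^ 2) ^ j) := by
    intro j hj
    have hjn := Finset.mem_range.1 hj
    have hjn' : (j : ℝ) * η ≤ n * η := by gcongr
    have h1 := ih j hjn (hjn'.trans hn)
    have e1 : Real.exp (-s * (j * η)) = e ^ j := by
      rw [hedef, ← Real.exp_nat_mul]; congr 1; ring
    rw [e1] at h1
    have h2 : ‖g j - T (Y j)‖ ≤ L * ε ^ 2 + L * r ^ 2 * (e ^ 2) ^ j := by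
      refine (hg j).trans ?_
      have h3 : ‖Y j‖ ^ 2 ≤ (ε + r * e ^ j) ^ 2 := by gcongr
      have h4 : (ε + r * e ^ j) ^ 2 ≤ 2 * ε ^ 2 + 2 * (r ^ 2 * (e ^ 2) ^ j) := by
        have : (e ^ 2) ^ j = (e ^ j) ^ 2 := by rw [← pow_mul, ← pow_mul, mul_comm]
        rw [this]
        nlinarith [sq_nonneg (ε - r * e ^ j)]
      have := mul_le_mul_of_nonneg_left (h3.trans h4) (show 0 ≤ L / 2 by positivity)
      linarith
    have := mul_le_mul_of_nonneg_left h2 (show 0 ≤ ((n - 1 - j : ℕ) : ℝ) * q ^ (n - 1 - j - 1) by positivity)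
    linarith
  have hsum := Finset.sum_le_sum hb
  rw [Finset.sum_add_distrib, ← Finset.mul_sum, ← Finset.mul_sum] at hsum
  have hs1 := uld_sum1 q hq0.le hq1 n
  have hs2 := uld_sum2 q e he0 hqe (by linarith) n
  have hs3 := mul_le_mul_of_nonneg_left hs1 (show 0 ≤ L * ε ^ 2 * η ^ 2 by positivity)
  have hs4 := mul_le_mul_of_nonneg_left hs2 (show 0 ≤ L * r ^ 2 * η ^ 2 by positivity)
  have hs5 := mul_le_mul_of_nonneg_left hsum (sq_nonneg η)
  have hs6 := mul_le_mul_of_nonneg_left hqs (show 0 ≤ L * ε ^ 2 by positivity)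
  have h7 : q ^ n * ‖Y 0‖ ≤ q ^ n * r := by gcongr
  have h8 : n * q ^ (n - 1) * (η * s * ‖Y 0‖) ≤ n * q ^ (n - 1) * (η * s * r) := by gcongr
  have h9 := hnoise n hnτ hn
  have h10 : 0 < r * Real.exp (-s * (n * η)) := by positivity
  linarith

lemma uld_det_B (hT : ∀ i, T (b i) = lam i • b i) (s η M τ Tesc ε r W L σ : ℝ) (hs : 0 < s) (hη : 0 < η) (hM : 0 < M)
    (hl : ∀ i, s ^ 2 ≤ lam i) (hlM : ∀ i, lam i ≤ M) (hη1 : η ≤ 1) (hsM : s ^ 2 ≤ M)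
    (hh : η * s ≤ 1 / 12) (hMs : η * M ≤ s / 12) (hε : 0 < ε) (hr : 0 < r) (hW : 1 ≤ W) (hL : 0 < L)
    (hτ : 1 ≤ s * τ) (hcase : 1 < η * M * τ) (hE1 : η * M ^ 2 * τ ≤ s / 144) (hE2 : η * M ^ 3 * τ ≤ s ^ 3 / 36)
    (hτe : τ * Real.exp (-s * τ) = ε ^ 2 / (8 * r ^ 2 * W))
    (hL1 : 4 * (L * ε) ≤ s ^ 2) (n1 : ℕ) (hn1 : τ / 2 ≤ n1 * η) (hn1' : n1 * η ≤ τ / 2 + η)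
    (V Y g w : ℕ → EuclideanSpace ℝ (Fin d))
    (hV : ∀ k, V (k + 1) = V k - η • ((2 * s) • V k + g k) + σ • w k)
    (hY : ∀ k, Y (k + 1) = Y k + η • V k)
    (hg : ∀ k, ‖g k - T (Y k)‖ ≤ L / 2 * ‖Y k‖ ^ 2)
    (hfirst : ∀ k : ℕ, k * η ≤ τ → ‖Y k‖ ≤ ε + r * Real.exp (-s * (k * η)))
    (hnoise : ∀ k : ℕ, τ ≤ (n1 + k : ℕ) * η → (n1 + k : ℕ) * η ≤ Tesc →
      ‖(uldNoise T (2 * s) η σ (fun i => w (n1 + i)) k).2‖ ≤ 3 * ε / 8) (n : ℕ) :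
    n * η ≤ Tesc → ‖Y n‖ ≤ ε + r * Real.exp (-s * (n * η)) := by
  have hτ0 : 0 < τ := by
    by_contra hc; push Not at hc; nlinarith
  have hM1 : M ≤ s / 144 := by
    have : M * 1 ≤ M * (η * M * τ) := by gcongr
    have e : M * (η * M * τ) = η * M ^ 2 * τ := by ring
    linarith
  have hs1 : s ≤ 1 / 144 := by
    by_contra hc; push Not at hc; nlinarith
  have hτ1 : 144 ≤ τ := by
    have : s * τ ≤ 1 / 144 * τ := by gcongr
    linarith
  have hre : ∀ j : ℕ, n1 ≤ j → r * Real.exp (-s * (j * η)) ≤ 2 / 5 * ε := by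
    intro j hj
    have h1 : (n1 : ℝ) * η ≤ j * η := by gcongr
    have h2 : s * (τ / 2) ≤ s * (j * η) := by gcongr; linarith
    have h3 : Real.exp (-s * (j * η)) ≤ Real.exp (-s * τ / 2) := Real.exp_le_exp.2 (by linarith)
    have h4 : (r * Real.exp (-s * τ / 2)) ^ 2 ≤ (2 / 5 * ε) ^ 2 := by
      have e : Real.exp (-s * τ / 2) ^ 2 = Real.exp (-s * τ) := by
        rw [← Real.exp_nat_mul]; congr 1; push_cast; ring
      rw [mul_pow, e]
      rw [eq_div_iff (by positivity)] at hτe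
      have h5 : 0 < Real.exp (-s * τ) * r ^ 2 := by positivity
      have h6 : 1 * 144 ≤ W * τ := mul_le_mul hW hτ1 (by norm_num) (by linarith)
      have h7 := mul_le_mul_of_nonneg_right h6 h5.le
      have e2 : τ * Real.exp (-s * τ) * (8 * r ^ 2 * W) = 8 * (W * τ * (Real.exp (-s * τ) * r ^ 2)) := by ring
      rw [e2] at hτe
      nlinarith
    have h5 := le_of_sq_le_sq h4 (by positivity)
    refine le_trans ?_ h5
    gcongr
  induction n using Nat.strong_induction_on with
  | _ n ih =>
  intro hn
  rcases le_total (n * η) τ with hnτ | hnτ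
  · exact hfirst n hnτ
  have hn1n : n1 + 1 < n := by
    have : ((n1 + 1 : ℕ) : ℝ) * η < n * η := by push_cast; linarith
    exact_mod_cast lt_of_mul_lt_mul_right this hη.le
  have hYb : ∀ j, n1 ≤ j → j < n → ‖Y j‖ ≤ 7 / 5 * ε := by
    intro j hj hjn
    have hjn' : (j : ℝ) * η ≤ n * η := by gcongr
    have h1 := ih j hjn (hjn'.trans hn)
    linarith [hre j hj]
  obtain ⟨k, rfl⟩ : ∃ k, n = n1 + k := ⟨n - n1, by omega⟩
  obtain ⟨q, hq⟩ : ∃ q, q = Real.exp (-(η * s) + η ^ 2 * M / 2) := ⟨_, rfl⟩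
  obtain ⟨hq0, hq1, hqe, hq2, hq3, hqs, he, hqM⟩ := uld_q s η M q hs hη hM hh hMs hq
  have hp := uld_pert b lam T hT s η q hη hs hl hq0.le
    (fun i => le_trans (by have := mul_le_mul_of_nonneg_left (hlM i) (sq_nonneg η); linarith) hqM)
    (fun i => V (n1 + i)) (fun i => Y (n1 + i)) (fun i => g (n1 + i)) (fun i => w (n1 + i)) σ
    (fun i => hV (n1 + i)) (fun i => hY (n1 + i)) k
  simp only [add_zero] at hp
  have hy0 := hYb n1 le_rfl (by omega)
  have hy1 : ‖Y (n1 + 1) - Y n1‖ ≤ 3 * ε := by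
    refine (norm_sub_le _ _).trans ?_
    have := hYb (n1 + 1) (by omega) (by omega)
    linarith
  have hB := uld_caseB s η M q τ ε L ‖Y n1‖ ‖Y (n1 + 1) - Y n1‖ k hs hη hM hh hMs hη1 hq hε hL hτ0 hcase hE1 hE2
    (by push_cast at hnτ; linarith) hL1 (norm_nonneg _) (by linarith) (norm_nonneg _) hy1
  have hb : ∀ j ∈ Finset.range k, ((k - 1 - j : ℕ) : ℝ) * q ^ (k - 1 - j - 1) * ‖g (n1 + j) - T (Y (n1 + j))‖ ≤
      L * ε ^ 2 * (((k - 1 - j : ℕ) : ℝ) * q ^ (k - 1 - j - 1)) := by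
    intro j hj
    have hjn := Finset.mem_range.1 hj
    have h1 := hYb (n1 + j) (by omega) (by omega)
    have h2 : ‖g (n1 + j) - T (Y (n1 + j))‖ ≤ L * ε ^ 2 := by
      refine (hg _).trans ?_
      have h3 : ‖Y (n1 + j)‖ ^ 2 ≤ (7 / 5 * ε) ^ 2 := by gcongr
      have := mul_le_mul_of_nonneg_left h3 (show 0 ≤ L / 2 by positivity)
      have h4 : 0 < L * ε ^ 2 := by positivity
      linarith
    have := mul_le_mul_of_nonneg_left h2 (show 0 ≤ ((k - 1 - j : ℕ) : ℝ) * q ^ (k - 1 - j - 1) by positivity)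
    linarith
  have hsum := Finset.sum_le_sum hb
  rw [← Finset.mul_sum] at hsum
  have hs1 := uld_sum1 q hq0.le hq1 k
  have hs3 := mul_le_mul_of_nonneg_left hs1 (show 0 ≤ L * ε ^ 2 * η ^ 2 by positivity)
  have hs5 := mul_le_mul_of_nonneg_left hsum (sq_nonneg η)
  have hs6 := mul_le_mul_of_nonneg_left hqs (show 0 ≤ L * ε ^ 2 by positivity)
  have h9 := hnoise k hnτ hn
  have h10 : 0 < r * Real.exp (-s * ((n1 + k : ℕ) * η)) := by positivity
  linarith

end

lemma uld_params (m M s d β δ η N Abar lam Cvd Tesc : ℝ) (hs : 0 < s) (hm : m = s ^ 2) (hM : 0 < M)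
    (hd : 1 ≤ d) (hβ : 0 < β) (hδ : 0 < δ) (hδ1 : δ < 1) (hN : 0 ≤ N) (hA : 0 ≤ Abar) (hT : 0 < Tesc)
    (hlam : lam = min (1 / 8) (m / (2 * M + (2 * s) ^ 2)))
    (hCvd : Cvd = (N + 4 * (d + Abar) / lam) / (β / 4 * (1 - 2 * lam)))
    (hη : η ≤ 4 * (2 * s) * δ ^ 2 / (9 * β * M ^ 2 * Cvd * Tesc)) (hη0 : 0 < η) :
    η * M ^ 2 * Tesc ≤ s / 144 ∧ η * M ^ 3 * Tesc ≤ s ^ 3 / 36 := by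
  have hm0 : 0 < m := by rw [hm]; positivity
  have hl0 : 0 < lam := by rw [hlam]; apply lt_min (by norm_num); positivity
  have hl1 : lam ≤ 1 / 8 := by rw [hlam]; exact min_le_left _ _
  have hl2 : lam * (2 * M) ≤ m := by
    have h1 : lam ≤ m / (2 * M + (2 * s) ^ 2) := by rw [hlam]; exact min_le_right _ _
    rw [le_div_iff₀ (by positivity)] at h1
    have : 0 ≤ lam * (2 * s) ^ 2 := by positivity
    linarith
  have h12 : 0 < 1 - 2 * lam := by linarith
  have hC : 16 / lam ≤ β * Cvd := by
    have e : β * Cvd = 4 * (N + 4 * (d + Abar) / lam) / (1 - 2 * lam) := by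
      rw [hCvd]; field_simp
    rw [e, le_div_iff₀ h12]
    have h1 : 1 / lam ≤ (d + Abar) / lam := by gcongr; linarith
    have h2 : 16 / lam * (1 - 2 * lam) ≤ 16 / lam * 1 := by gcongr; linarith
    have e3 : 16 / lam * 1 = 16 * (1 / lam) := by ring
    have e4 : 4 * (N + 4 * (d + Abar) / lam) = 4 * N + 16 * ((d + Abar) / lam) := by ring
    linarith
  have hC0 : 0 < β * Cvd := lt_of_lt_of_le (by positivity) hC
  have hden : 0 < 9 * β * M ^ 2 * Cvd * Tesc := by
    have : 9 * β * M ^ 2 * Cvd * Tesc = 9 * (β * Cvd) * M ^ 2 * Tesc := by ring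
    rw [this]; positivity
  rw [le_div_iff₀ hden] at hη
  have h1 : η * M ^ 2 * Tesc * (16 / lam) ≤ η * M ^ 2 * Tesc * (β * Cvd) := by gcongr
  have h2 : 4 * (2 * s) * δ ^ 2 ≤ 8 * s := by
    have : δ ^ 2 ≤ 1 := by nlinarith
    nlinarith
  have h3 : η * M ^ 2 * Tesc * (16 / lam) ≤ 8 / 9 * s := by linarith
  have h4 : η * M ^ 2 * Tesc ≤ s * lam / 18 := by
    rw [mul_div_assoc', div_le_iff₀ hl0] at h3
    linarith
  constructor
  · have : s * lam ≤ s * (1 / 8) := by gcongr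
    linarith
  · have h5 := mul_le_mul_of_nonneg_right h4 hM.le
    have h6 := mul_le_mul_of_nonneg_left hl2 hs.le
    rw [hm] at h6
    linarith

lemma uld_eps (m s CH L ε r W : ℝ) (hs : 0 < s) (hm : m = s ^ 2) (hCH : 0 ≤ CH) (hL : 0 < L) (hε0 : 0 < ε) (hr : 0 < r)
    (hW : W = Real.sqrt (CH + 2 + (m + 1) ^ 2))
    (h1 : ε < Real.sqrt ((CH + 2 + (m + 1) ^ 2) / ((CH + 2) * m + (m + 1) ^ 2)) * r)
    (h3 : ε < s / (4 * L * (Real.sqrt (CH + 2) + (m + 1) / s +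
      (Real.sqrt ((CH + 2) * m) + (m + 1)) / (8 * Real.sqrt (CH + 2 + (m + 1) ^ 2))))) :
    1 ≤ W ∧ 6 * (s * ε) ^ 2 ≤ (r * W) ^ 2 ∧ 4 * (L * ε) ≤ s ^ 2 ∧ 12 * (L * ε) ≤ s := by
  have hm0 : 0 < m := by rw [hm]; positivity
  refine ⟨?_, ?_, ?_⟩
  · rw [hW]; apply Real.one_le_sqrt.2; nlinarith
  · have hW2 : W ^ 2 = CH + 2 + (m + 1) ^ 2 := by rw [hW, Real.sq_sqrt (by positivity)]
    have h4 := pow_le_pow_left₀ hε0.le h1.le 2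
    rw [mul_pow, Real.sq_sqrt (by positivity), ← hW2, div_mul_eq_mul_div, le_div_iff₀ (by positivity)] at h4
    have h5 : 6 * m ≤ (CH + 2) * m + (m + 1) ^ 2 := by nlinarith [sq_nonneg (m - 1), mul_nonneg hCH hm0.le]
    have h6 := mul_le_mul_of_nonneg_left h5 (sq_nonneg ε)
    have e : 6 * (s * ε) ^ 2 = ε ^ 2 * (6 * m) := by rw [hm]; ring
    rw [e]; linarith
  · obtain ⟨Br, hBr⟩ : ∃ Br, Br = Real.sqrt (CH + 2) + (m + 1) / s +
      (Real.sqrt ((CH + 2) * m) + (m + 1)) / (8 * Real.sqrt (CH + 2 + (m + 1) ^ 2)) := ⟨_, rfl⟩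
    rw [← hBr] at h3
    have hlast : 0 ≤ (Real.sqrt ((CH + 2) * m) + (m + 1)) / (8 * Real.sqrt (CH + 2 + (m + 1) ^ 2)) := by positivity
    have hs1 : 1 ≤ Real.sqrt (CH + 2) := Real.one_le_sqrt.2 (by linarith)
    have hs2 : 2 ≤ (m + 1) / s := by
      rw [le_div_iff₀ hs, hm]; nlinarith [sq_nonneg (s - 1)]
    have hs3 : 1 / s ≤ (m + 1) / s := by gcongr; linarith
    have hB1 : 3 ≤ Br := by linarith
    have hB2 : 1 / s ≤ Br := by linarith
    have hB0 : 0 < Br := by linarith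
    rw [lt_div_iff₀ (by positivity)] at h3
    have hLe : 0 < 4 * (L * ε) := by positivity
    constructor
    · have := mul_le_mul_of_nonneg_left hB2 hLe.le
      rw [mul_one_div, div_le_iff₀ hs] at this
      nlinarith
    · have := mul_le_mul_of_nonneg_left hB1 hLe.le
      linarith

lemma uld_grad {d : ℕ} (F : EuclideanSpace ℝ (Fin d) → ℝ) (hF : ContDiff ℝ 2 F) : Differentiable ℝ (∇ F) := by
  have h1 : Differentiable ℝ (fderiv ℝ F) := (hF.fderiv_right (m := 1) (by norm_num)).differentiable (by norm_num)
  exact ((InnerProductSpace.toDual ℝ (EuclideanSpace ℝ (Fin d))).symm.differentiable).comp h1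

lemma uld_grad_zero {d : ℕ} (F : EuclideanSpace ℝ (Fin d) → ℝ) (x : EuclideanSpace ℝ (Fin d)) (h : IsLocalMin F x) :
    ∇ F x = 0 := by
  rw [gradient, h.fderiv_eq_zero, map_zero]

lemma uld_opnorm {d : ℕ} (F : EuclideanSpace ℝ (Fin d) → ℝ) (M : ℝ) (hM : 0 < M)
    (hFlip : ∀ x y, ‖∇ F x - ∇ F y‖ ≤ M * ‖x - y‖) (x : EuclideanSpace ℝ (Fin d)) : ‖fderiv ℝ (∇ F) x‖ ≤ M := by
  exact norm_fderiv_le_of_lip' ℝ hM.le (Filter.Eventually.of_forall fun y => hFlip y x)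

lemma uld_eig {d : ℕ} (H : Matrix (Fin d) (Fin d) ℝ) (hH : H.IsHermitian) (i : Fin d) :
    (Matrix.toEuclideanCLM (𝕜 := ℝ) H : EuclideanSpace ℝ (Fin d) →L[ℝ] EuclideanSpace ℝ (Fin d))
      (hH.eigenvectorBasis i) = hH.eigenvalues i • hH.eigenvectorBasis i := by
  have := hH.mulVec_eigenvectorBasis i
  ext j
  have h2 := congrFun this j
  rw [Matrix.ofLp_toEuclideanCLM, h2]; rfl

set_option maxHeartbeats 4000000 in
/-- Recurrence/escape dichotomy for the underdamped Langevin dynamics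
with critical friction `γ = 2√m`. -/
theorem uld_recurrence_escape_critical
    {Ω : Type*} [MeasurableSpace Ω] (P : Measure Ω) [IsProbabilityMeasure P]
    {d : ℕ} (hd : 1 ≤ d)
    -- the objective and its regularity
    (F : EuclideanSpace ℝ (Fin d) → ℝ) (hF : ContDiff ℝ 2 F)
    (m b M L A B : ℝ)
    (hm : 0 < m) (hb : 0 < b) (hM : 0 < M) (hL : 0 < L) (hA : 0 < A) (hB : 0 < B)
    (hFlip : ∀ x y, ‖∇ F x - ∇ F y‖ ≤ M * ‖x - y‖)
    (hHlip : ∀ x y, ‖fderiv ℝ (∇ F) x - fderiv ℝ (∇ F) y‖ ≤ L * ‖x - y‖)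
    (hF0 : |F 0| ≤ A) (hgrad0 : ‖∇ F 0‖ ≤ B)
    (hdiss : ∀ x, ⟪x, ∇ F x⟫ ≥ m * ‖x‖ ^ 2 - b)
    (R : ℝ) (hR : R = Real.sqrt (b / m))
    -- the local minimum and its positive-definite Hessian with smallest eigenvalue m
    (xstar : EuclideanSpace ℝ (Fin d)) (hxstar : IsLocalMin F xstar)
    (H : Matrix (Fin d) (Fin d) ℝ)
    (hHdef : (Matrix.toEuclideanCLM (𝕜 := ℝ) H : EuclideanSpace ℝ (Fin d) →L[ℝ]
      EuclideanSpace ℝ (Fin d)) = fderiv ℝ (∇ F) xstar)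
    (hH : H.PosDef)
    (hm_le : ∀ i, m ≤ hH.1.eigenvalues i) (hm_eq : ∃ i, hH.1.eigenvalues i = m)
    -- C_H: the max of (1+λ)²/(λ-m) over eigenvalues λ > m, and 0 if there is none
    (CH : ℝ)
    (hCH_le : ∀ i, m < hH.1.eigenvalues i →
      (1 + hH.1.eigenvalues i) ^ 2 / (hH.1.eigenvalues i - m) ≤ CH)
    (hCH_eq : (∃ i, m < hH.1.eigenvalues i) → ∃ i, m < hH.1.eigenvalues i ∧
      CH = (1 + hH.1.eigenvalues i) ^ 2 / (hH.1.eigenvalues i - m))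
    (hCH_zero : (¬ ∃ i, m < hH.1.eigenvalues i) → CH = 0)
    -- parameters
    (γ : ℝ) (hγ : γ = 2 * Real.sqrt m)
    (δ r ε 𝒯 : ℝ) (hδ : 0 < δ ∧ δ < 1) (hr : 0 < r) (h𝒯 : 0 < 𝒯)
    -- the admissible range of ε
    (εb₁ εb₂ εb₃ : ℝ)
    (hεb₁ : εb₁ = Real.sqrt ((CH + 2 + (m + 1) ^ 2) / ((CH + 2) * m + (m + 1) ^ 2)) * r)
    (hεb₂ : εb₂ = 2 * Real.sqrt 2 * (CH + 2 + (m + 1) ^ 2) ^ ((1 : ℝ) / 4) *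
      Real.exp (-(1 : ℝ) / 2) * r / m ^ ((1 : ℝ) / 4))
    (hεb₃ : εb₃ = Real.sqrt m / (4 * L * (Real.sqrt (CH + 2) + (m + 1) / Real.sqrt m +
      (Real.sqrt ((CH + 2) * m) + (m + 1)) / (8 * Real.sqrt (CH + 2 + (m + 1) ^ 2)))))
    (hε0 : 0 < ε) (hε : ε < min εb₁ (min εb₂ εb₃))
    -- recurrence and escape times
    (Trec : ℝ) (hTrec₁ : 1 / Real.sqrt m ≤ Trec)
    (hTrec₂ : Trec * Real.exp (-Real.sqrt m * Trec) =
      ε ^ 2 / (8 * r ^ 2 * Real.sqrt (CH + 2 + (m + 1) ^ 2)))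
    (Tesc : ℝ) (hTesc : Tesc = Trec + 𝒯)
    -- stepsize and inverse temperature
    (η β : ℝ) (hη0 : 0 < η) (hβ0 : 0 < β)
    -- auxiliary constants
    (lam Abar N Cxc Cvc Cvd K₁ K₂ : ℝ)
    (hlam : lam = min (1 / 8) (m / (2 * M + γ ^ 2)))
    (hAbar : Abar = β * m / (2 * M + γ ^ 2) *
      (B ^ 2 / (2 * M + γ ^ 2) + b / m * (M + γ ^ 2 / 2) + A))
    (hN : N = (β * M / 2 + β * γ ^ 2 * (2 - lam) / 4) * R ^ 2 + β * B * R + β * A)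
    (hCxc : Cxc = (N + (d + Abar) / lam) / (1 / 8 * (1 - 2 * lam) * β * γ ^ 2))
    (hCvc : Cvc = (N + (d + Abar) / lam) / (β / 4 * (1 - 2 * lam)))
    (hCvd : Cvd = (N + 4 * (d + Abar) / lam) / (β / 4 * (1 - 2 * lam)))
    (hK₁ : K₁ = max (32 * M ^ 2 * (1 / 2 + γ) / ((1 - 2 * lam) * β * γ ^ 2))
      (8 * (M / 2 + γ ^ 2 / 4 - γ ^ 2 * lam / 4 + γ) / (β * (1 - 2 * lam))))
    (hK₂ : K₂ = 2 * B ^ 2 * (1 / 2 + γ))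
    (hη : η ≤ min 1 (min (ε * Real.exp (-(1 + γ + M)) / (8 * B))
      (min (δ * ε ^ 2 * Real.exp (-2 * (1 + γ + M)) /
          (384 * (M ^ 2 * Cxc + (1 + γ) ^ 2 * Cvc) * Trec))
        (min (4 * γ * δ ^ 2 / (9 * β * M ^ 2 * Cvd * Tesc))
          (min (γ * (d + Abar) / (K₂ * β)) (γ * lam / (2 * K₁)))))))
    (hβ : β ≥ max
      (256 * (2 * CH * m + 4 * m + (m + 1) ^ 2) / (m * ε ^ 2) *
        (d * Real.log 2 + Real.log ((6 * Real.sqrt (4 * m + M ^ 2 + 1) * 𝒯 + 3) / δ)))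
      (512 * d * γ * η *
          Real.log ((2 : ℝ) ^ ((1 : ℝ) / 4) * Real.exp ((1 : ℝ) / 4) * 6 * Trec / (δ * η)) /
        (ε ^ 2 * Real.exp (-2 * (1 + γ + M) * η))))
    -- i.i.d. standard Gaussian noise
    (ξ : ℕ → Ω → EuclideanSpace ℝ (Fin d)) (hξmeas : ∀ k, Measurable (ξ k))
    (hξindep : iIndepFun ξ P)
    (hξ : ∀ k, Measure.map (ξ k) P = stdGaussianE d)
    -- the ULD iterates
    (x0 : EuclideanSpace ℝ (Fin d)) (hx0R : ‖x0‖ ≤ R) (hx0r : ‖x0 - xstar‖ ≤ r)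
    (X V : ℕ → Ω → EuclideanSpace ℝ (Fin d))
    (hX0 : ∀ ω, X 0 ω = x0) (hV0 : ∀ ω, V 0 ω = 0)
    (hVrec : ∀ k ω, V (k + 1) ω =
      V k ω - η • (γ • V k ω + ∇ F (X k ω)) + Real.sqrt (2 * γ * β⁻¹ * η) • ξ k ω)
    (hXrec : ∀ k ω, X (k + 1) ω = X k ω + η • V k ω) :
    ENNReal.ofReal (1 - δ) ≤
      P {ω | (∃ k : ℕ, (k : ℝ) ≤ Trec / η ∧
            (1 / 2) * (ε + r * Real.exp (-Real.sqrt m * (k * η))) ≤ ‖X k ω - xstar‖) ∨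
          (∀ k : ℕ, Trec / η ≤ (k : ℝ) → (k : ℝ) ≤ Tesc / η →
            ‖X k ω - xstar‖ ≤ ε + r * Real.exp (-Real.sqrt m * (k * η)))} := by
  obtain ⟨s, hsdef⟩ : ∃ s, s = Real.sqrt m := ⟨_, rfl⟩
  rw [← hsdef] at hγ hTrec₁ hTrec₂ hεb₃ ⊢
  have hs : 0 < s := by rw [hsdef]; exact Real.sqrt_pos.2 hm
  have hs2 : m = s ^ 2 := by rw [hsdef, Real.sq_sqrt hm.le]
  obtain ⟨hδ0, hδ1⟩ := hδ
  -- eigenbasis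
  set T := fderiv ℝ (∇ F) xstar with hTdef
  set bs := hH.1.eigenvectorBasis with hbs
  set lm := hH.1.eigenvalues with hlm
  have hT : ∀ i, T (bs i) = lm i • bs i := by
    intro i; rw [← hHdef]; exact uld_eig H hH.1 i
  have hlM : ∀ i, lm i ≤ M := by
    intro i
    have h1 := (T.le_opNorm (bs i)).trans (mul_le_mul_of_nonneg_right (uld_opnorm F M hM hFlip xstar) (norm_nonneg _))
    rw [hT, norm_smul, bs.norm_eq_one, mul_one, mul_one] at h1
    exact (le_abs_self _).trans h1
  have hl : ∀ i, s ^ 2 ≤ lm i := fun i => by rw [← hs2]; exact hm_le i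
  have hmM : s ^ 2 ≤ M := by
    obtain ⟨i, hi⟩ := hm_eq
    rw [← hs2, ← hi]; exact hlM i
  have hCH0 : 0 ≤ CH := by
    by_cases h : ∃ i, m < lm i
    · obtain ⟨i, hi, h2⟩ := hCH_eq h
      rw [h2]; have : 0 < lm i - m := by linarith
      positivity
    · rw [hCH_zero h]
  -- parameters
  have hsτ : 1 ≤ s * Trec := by
    rw [div_le_iff₀ hs] at hTrec₁; linarith
  have hTrec0 : 0 < Trec := lt_of_lt_of_le (by positivity) hTrec₁
  have hTesc0 : 0 < Tesc := by rw [hTesc]; linarith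
  have hη1 : η ≤ 1 := hη.trans (min_le_left _ _)
  have hη4 : η ≤ 4 * (2 * s) * δ ^ 2 / (9 * β * M ^ 2 * Cvd * Tesc) := by
    rw [← hγ]
    exact hη.trans ((min_le_right _ _).trans ((min_le_right _ _).trans ((min_le_right _ _).trans (min_le_left _ _))))
  have hR0 : 0 ≤ R := by rw [hR]; positivity
  have hlam1 : lam ≤ 1 / 8 := by rw [hlam]; exact min_le_left _ _
  have hN0 : 0 ≤ N := by
    rw [hN]
    have : 0 ≤ 2 - lam := by linarith
    positivity
  have hAbar0 : 0 ≤ Abar := by rw [hAbar]; positivity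
  obtain ⟨E1, E2⟩ := uld_params m M s d β δ η N Abar lam Cvd Tesc hs hs2 hM (by exact_mod_cast hd) hβ0 hδ0 hδ1 hN0 hAbar0
    hTesc0 (by rw [hlam, hγ]) hCvd hη4 hη0
  have hTT : Trec ≤ Tesc := by linarith
  have E1' : η * M ^ 2 * Trec ≤ s / 144 := le_trans (by gcongr) E1
  have E2' : η * M ^ 3 * Trec ≤ s ^ 3 / 36 := le_trans (by gcongr) E2
  have hηM2 : η * M ^ 2 ≤ s ^ 2 / 144 := by
    have h1 : η * M ^ 2 * 1 ≤ η * M ^ 2 * (s * Trec) := by gcongr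
    have h2 := mul_le_mul_of_nonneg_left E1' hs.le
    linarith
  have hηM : η * M ≤ 1 / 144 := by
    have h1 : η * M ^ 2 ≤ M / 144 := by linarith
    by_contra hc
    push Not at hc
    have := mul_lt_mul_of_pos_right hc hM
    linarith
  have hh : η * s ≤ 1 / 12 := by
    apply le_of_sq_le_sq _ (by norm_num)
    have h1 : (η * s) ^ 2 = η * (η * s ^ 2) := by ring
    have h2 : η * s ^ 2 ≤ η * M := by gcongr
    have h3 : η * (η * s ^ 2) ≤ 1 * (η * s ^ 2) := by gcongr
    rw [h1]; linarith
  have hMs : η * M ≤ s / 12 := by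
    apply le_of_sq_le_sq _ (by positivity)
    have h1 : (η * M) ^ 2 = η * (η * M ^ 2) := by ring
    have h3 : η * (η * M ^ 2) ≤ 1 * (η * M ^ 2) := by gcongr
    rw [h1, div_pow]; linarith
  have hl2 : ∀ i, η * lm i ≤ s / 12 := fun i => le_trans (by gcongr; exact hlM i) hMs
  obtain ⟨W, hWdef⟩ : ∃ W, W = Real.sqrt (CH + 2 + (m + 1) ^ 2) := ⟨_, rfl⟩
  rw [← hWdef] at hTrec₂
  obtain ⟨hW, hA1, hL1, hL2⟩ := uld_eps m s CH L ε r W hs hs2 hCH0 hL hε0 hr hWdef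
    (by rw [← hεb₁]; exact hε.trans_le (min_le_left _ _))
    (by rw [← hεb₃]; exact hε.trans_le ((min_le_right _ _).trans (min_le_right _ _)))
  obtain ⟨σ, hσdef⟩ : ∃ σ, σ = Real.sqrt (2 * γ * β⁻¹ * η) := ⟨_, rfl⟩
  rw [← hσdef] at hVrec
  have hσ : σ ^ 2 = 4 * s * η / β := by
    have hγ0 : 0 < γ := by rw [hγ]; positivity
    rw [hσdef, Real.sq_sqrt (by positivity), hγ]; field_simp; ring
  obtain ⟨Sd, hSd⟩ : ∃ Sd, Sd = Real.sqrt (4 * m + M ^ 2 + 1) := ⟨_, rfl⟩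
  have hSd0 : 0 < Sd := by rw [hSd]; apply Real.sqrt_pos.2; positivity
  have hSd2 : 2 * s ≤ Sd := by
    rw [hSd]; apply Real.le_sqrt_of_sq_le
    have h4 : (2 * s) ^ 2 = 4 * m := by rw [mul_pow, hs2]; norm_num
    have h5 := sq_nonneg M
    rw [h4]; linarith only [h5]
  have hβ' : 256 / (s ^ 2 * ε ^ 2) * (d * Real.log 2 + Real.log ((6 * Sd * 𝒯 + 3) / δ)) ≤ β := by
    refine le_trans ?_ ((le_max_left _ _).trans hβ)
    rw [← hSd, ← hs2]
    have hlog : 0 ≤ Real.log ((6 * Sd * 𝒯 + 3) / δ) := by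
      apply Real.log_nonneg
      rw [le_div_iff₀ hδ0]
      have : 0 < Sd * 𝒯 := by positivity
      linarith
    have hlog2 : 0 ≤ Real.log 2 := Real.log_nonneg (by norm_num)
    gcongr
    have h6 : 0 ≤ CH * m := by positivity
    have h7 : (m + 1) ^ 2 = m ^ 2 + 2 * m + 1 := by ring
    have h8 := sq_nonneg m
    linarith only [h6, h7, h8, hm]
  -- reduction to the deterministic statement
  have hred : ∃ n1 : ℕ, n1 * η ≤ Trec ∧ ∀ ω,
      (∀ k : ℕ, Trec ≤ (n1 + k : ℕ) * η → (n1 + k : ℕ) * η ≤ Tesc →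
        ‖(uldNoise T (2 * s) η σ (fun i => ξ (n1 + i) ω) k).2‖ ≤ 3 * ε / 8) →
      (∀ k : ℕ, k * η ≤ Trec → ‖X k ω - xstar‖ ≤ ε + r * Real.exp (-s * (k * η))) →
      ∀ n : ℕ, n * η ≤ Tesc → ‖X n ω - xstar‖ ≤ ε + r * Real.exp (-s * (n * η)) := by
    have hgd := uld_grad F hF
    have hg0 := uld_grad_zero F xstar hxstar
    have hg : ∀ k ω, ‖∇ F (X k ω) - T (X k ω - xstar)‖ ≤ L / 2 * ‖X k ω - xstar‖ ^ 2 := by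
      intro k ω
      have := uld_rem (∇ F) hgd L hHlip xstar (X k ω - xstar)
      rwa [add_sub_cancel, hg0, sub_zero] at this
    have hV' : ∀ ω k, V (k + 1) ω = V k ω - η • ((2 * s) • V k ω + ∇ F (X k ω)) + σ • ξ k ω := by
      intro ω k; rw [hVrec, hγ]
    have hY' : ∀ ω k, X (k + 1) ω - xstar = (X k ω - xstar) + η • V k ω := by
      intro ω k; rw [hXrec]; abel
    rcases le_or_gt (η * M * Trec) 1 with hcase | hcase
    · refine ⟨0, by simpa using hTrec0.le, fun ω hnoise hfirst n => ?_⟩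
      simp only [zero_add] at hnoise
      exact uld_det_A bs lm T hT s η M Trec Tesc ε r W L σ hs hη0 hM hl hlM hh hMs hε0 hr hW hL hsτ hcase hTrec₂ hA1 hL1 hL2
        (fun k => V k ω) (fun k => X k ω - xstar) (fun k => ∇ F (X k ω)) (fun k => ξ k ω) (hV' ω) (hY' ω) (hV0 ω)
        (by simp only [hX0]; exact hx0r) (fun k => hg k ω) hfirst hnoise n
    · obtain ⟨n1, hn1⟩ : ∃ n1, n1 = ⌈Trec / (2 * η)⌉₊ := ⟨_, rfl⟩
      have h1 : Trec / (2 * η) ≤ n1 := by rw [hn1]; exact Nat.le_ceil _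
      have h2 : (n1 : ℝ) < Trec / (2 * η) + 1 := by rw [hn1]; exact Nat.ceil_lt_add_one (by positivity)
      have h1' : Trec / 2 ≤ n1 * η := by
        rw [div_le_iff₀ (by positivity)] at h1; linarith
      have h2' : n1 * η ≤ Trec / 2 + η := by
        have := mul_le_mul_of_nonneg_right h2.le hη0.le
        have e : (Trec / (2 * η) + 1) * η = Trec / 2 + η := by field_simp
        linarith
      have h3 : η ≤ Trec / 12 := by
        by_contra hc
        push Not at hc
        have := mul_lt_mul_of_pos_left hc hs
        linarith
      refine ⟨n1, by linarith, fun ω hnoise hfirst n => ?_⟩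
      exact uld_det_B bs lm T hT s η M Trec Tesc ε r W L σ hs hη0 hM hl hlM hη1 hmM hh hMs hε0 hr hW hL hsτ hcase E1' E2'
        hTrec₂ hL1 n1 h1' h2'
        (fun k => V k ω) (fun k => X k ω - xstar) (fun k => ∇ F (X k ω)) (fun k => ξ k ω) (hV' ω) (hY' ω)
        (fun k => hg k ω) hfirst hnoise n
  obtain ⟨n1, hn1, hdet⟩ := hred
  obtain ⟨K0, hK0⟩ : ∃ K0, K0 = ⌈Trec / η⌉₊ - n1 := ⟨_, rfl⟩
  have hn1K : n1 ≤ ⌈Trec / η⌉₊ := by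
    have h1 : (n1 : ℝ) ≤ Trec / η := by rwa [le_div_iff₀ hη0]
    exact_mod_cast h1.trans (Nat.le_ceil _)
  have hbad := uld_noise_prob bs lm T P (fun i => ξ (n1 + i)) (fun k => hξmeas _)
    (hξindep.precomp (add_right_injective n1)) (fun k => hξ _) hT s η β σ hs hη0 hβ0 hh hσ hl hl2 Sd ε δ 𝒯 hSd0 hSd2
    hε0 hδ0 hδ1 h𝒯 hβ' K0
  set bad := {ω | ∃ k : ℕ, K0 ≤ k ∧ (k : ℝ) ≤ K0 + 𝒯 / η ∧
      3 * ε / 8 ≤ ‖(uldNoise T (2 * s) η σ (fun n => ξ (n1 + n) ω) k).2‖} with hbaddef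
  set good := {ω | (∃ k : ℕ, (k : ℝ) ≤ Trec / η ∧
            (1 / 2) * (ε + r * Real.exp (-s * (k * η))) ≤ ‖X k ω - xstar‖) ∨
          (∀ k : ℕ, Trec / η ≤ (k : ℝ) → (k : ℝ) ≤ Tesc / η →
            ‖X k ω - xstar‖ ≤ ε + r * Real.exp (-s * (k * η)))} with hgooddef
  have hcov : Set.univ ⊆ good ∪ bad := by
    intro ω _
    by_cases hb' : ω ∈ bad
    · exact Or.inr hb'
    left
    by_cases h1 : ∃ k : ℕ, (k : ℝ) ≤ Trec / η ∧ (1 / 2) * (ε + r * Real.exp (-s * (k * η))) ≤ ‖X k ω - xstar‖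
    · exact Or.inl h1
    right
    push Not at h1
    intro k _ hk2
    rw [le_div_iff₀ hη0] at hk2
    refine hdet ω ?_ ?_ k hk2
    · intro j hj1 hj2
      by_contra hc
      push Not at hc
      apply hb'
      refine ⟨j, ?_, ?_, hc.le⟩
      · rw [← div_le_iff₀ hη0] at hj1
        have := Nat.ceil_le.2 hj1
        omega
      · rw [← le_div_iff₀ hη0, hTesc, add_div] at hj2
        have h5 : ((K0 + n1 : ℕ) : ℝ) = (⌈Trec / η⌉₊ : ℕ) := by
          congr 1; omega
        have h6 := Nat.le_ceil (Trec / η)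
        push_cast at h5 hj2
        linarith
    · intro j hj
      have h2 := h1 j (by rwa [le_div_iff₀ hη0])
      have h3 : 0 < ε + r * Real.exp (-s * (j * η)) := by positivity
      linarith
  have h1 : (1 : ℝ≥0∞) ≤ P good + ENNReal.ofReal δ := by
    calc (1 : ℝ≥0∞) = P Set.univ := measure_univ.symm
      _ ≤ P (good ∪ bad) := measure_mono hcov
      _ ≤ P good + P bad := measure_union_le _ _
      _ ≤ _ := by gcongr
  rw [ENNReal.ofReal_sub _ hδ0.le, ENNReal.ofReal_one]
  exact tsub_le_iff_right.2 h1

end
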